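/- arXiv:1801.00661 — 6 statements merged into one kernel-verified Lean document; each statement's English description precedes it below -/
import Mathlib

section
/- (Generator) Let p be a good heat kernel for L^κ, and define P_t f(x) := ∫_{ℝ^d} p(t,x,y) f(y) dy for t > 0. Let ε₀ > 0 and let f : ℝ^d → ℝ be bounded and twice continuously differentiable with bounded first and second derivatives whose second-order partial derivatives are uniformly ε₀-Hölder continuous. Then for every x ∈ ℝ^d the limit L^κ f(x) = lim_{ε↓0} ∫_{|z|>ε} (f(x+z) − f(x)) κ(x,z) J(|z|) dz exists, and sup_{x∈ℝ^d} | (P_t f(x) − f(x))/t − L^κ f(x) | → 0 as t ↓ 0. -/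
open MeasureTheory Filter Set

attribute [local instance] Classical.propDecidable

noncomputable def Phi (φ : ℝ → ℝ) (r : ℝ) : ℝ :=
  if r ≤ 1 then r ^ 2 / (2 * ∫ s in Set.Ioo (0:ℝ) r, s / φ s)
  else (1 / (2 * ∫ s in Set.Ioo (0:ℝ) 1, s / φ s)) * r ^ 2

noncomputable def theta (d : ℕ) (φ : ℝ → ℝ) (b β : ℝ) (r : ℝ) : ℝ :=
  if r ≤ 1 then 1 / (r ^ d * Phi φ r)
  else if β < 1 then Real.exp (-b * r ^ β)
  else r ^ (-(d : ℝ) - 1) * Real.exp (-(b / 5) * r)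

noncomputable def Gfun (d : ℕ) (φ : ℝ → ℝ) (b β : ℝ) (Φinv : ℝ → ℝ)
    (t : ℝ) (x : EuclideanSpace ℝ (Fin d)) : ℝ :=
  if x = 0 then 1 / (t * Φinv t ^ d)
  else min (1 / (t * Φinv t ^ d)) (theta d φ b β ‖x‖)

noncomputable def Gtil (d : ℕ) (φ : ℝ → ℝ) (Φinv : ℝ → ℝ)
    (t : ℝ) (x : EuclideanSpace ℝ (Fin d)) : ℝ :=
  if x = 0 then 1 / (t * Φinv t ^ d)
  else min (1 / (t * Φinv t ^ d)) (1 / (‖x‖ ^ d * Phi φ ‖x‖))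

noncomputable def Leps (d : ℕ)
    (κ : EuclideanSpace ℝ (Fin d) → EuclideanSpace ℝ (Fin d) → ℝ) (J : ℝ → ℝ)
    (ε : ℝ) (f : EuclideanSpace ℝ (Fin d) → ℝ) (x : EuclideanSpace ℝ (Fin d)) : ℝ :=
  ∫ z in {z : EuclideanSpace ℝ (Fin d) | ε < ‖z‖}, (f (x + z) - f x) * (κ x z * J ‖z‖)

structure PhiInvSpec (φ Φinv : ℝ → ℝ) : Prop where
  pos : ∀ t : ℝ, 0 < t → 0 < Φinv t
  right_inv : ∀ t : ℝ, 0 < t → Phi φ (Φinv t) = t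
  left_inv : ∀ r : ℝ, 0 < r → Φinv (Phi φ r) = r

structure HKAssumptions (d : ℕ) (φ J : ℝ → ℝ) (a₁ α₁ C₀ a b β : ℝ)
    (κ : EuclideanSpace ℝ (Fin d) → EuclideanSpace ℝ (Fin d) → ℝ)
    (κ₀ κ₁ κ₂ δ : ℝ) : Prop where
  hd : 1 ≤ d
  φ_cont : ContinuousOn φ (Set.Icc 0 1)
  φ_mono : StrictMonoOn φ (Set.Icc 0 1)
  φ_zero : φ 0 = 0
  a₁_pos : 0 < a₁
  α₁_pos : 0 < α₁
  α₁_le : α₁ ≤ 2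
  hLS : ∀ r R : ℝ, 0 < r → r ≤ R → R ≤ 1 → a₁ * (R / r) ^ α₁ ≤ φ R / φ r
  hI : MeasureTheory.IntegrableOn (fun s => s / φ s) (Set.Ioo (0:ℝ) 1)
  hC₀ : C₀ = ∫ s in Set.Ioo (0:ℝ) 1, s / φ s
  J_pos : ∀ r : ℝ, 0 < r → 0 < J r
  J_cont : ContinuousOn J (Set.Ioi 0)
  J_anti : AntitoneOn J (Set.Ioi 0)
  J_diff : ∀ r : ℝ, 0 < r → DifferentiableAt ℝ J r
  ha : 1 ≤ a
  hb : 0 < b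
  β_pos : 0 < β
  β_le : β ≤ 1
  hJ1_low : ∀ r : ℝ, 0 < r → r ≤ 1 → a⁻¹ / (r ^ d * φ r) ≤ J r
  hJ1_up : ∀ r : ℝ, 0 < r → r ≤ 1 → J r ≤ a / (r ^ d * φ r)
  hJ1_exp : ∀ r : ℝ, 1 < r → J r ≤ a * Real.exp (-b * r ^ β)
  hJ2 : AntitoneOn (fun r => -(deriv J r) / r) (Set.Ioi 0)
  κ_meas : Measurable (Function.uncurry κ)
  κ₀_pos : 0 < κ₀
  κ₁_pos : 0 < κ₁
  κ₂_pos : 0 < κ₂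
  δ_pos : 0 < δ
  δ_lt : δ < 1
  κ_low : ∀ x z, κ₀ ≤ κ x z
  κ_up : ∀ x z, κ x z ≤ κ₁
  κ_sym : ∀ x z, κ x z = κ x (-z)
  κ_holder : ∀ x y z, |κ x z - κ y z| ≤ κ₂ * ‖x - y‖ ^ δ

structure GoodHeatKernel (d : ℕ) (φ J : ℝ → ℝ) (b β : ℝ) (Φinv : ℝ → ℝ)
    (κ : EuclideanSpace ℝ (Fin d) → EuclideanSpace ℝ (Fin d) → ℝ)
    (p : ℝ → EuclideanSpace ℝ (Fin d) → EuclideanSpace ℝ (Fin d) → ℝ) : Prop where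
  cont : ContinuousOn
      (fun q : ℝ × EuclideanSpace ℝ (Fin d) × EuclideanSpace ℝ (Fin d) => p q.1 q.2.1 q.2.2)
      (Set.Ioi (0:ℝ) ×ˢ (Set.univ : Set (EuclideanSpace ℝ (Fin d) × EuclideanSpace ℝ (Fin d))))
  eqn : ∀ t : ℝ, 0 < t → ∀ x y : EuclideanSpace ℝ (Fin d), x ≠ y →
      ∃ L : ℝ, Filter.Tendsto (fun ε => Leps d κ J ε (fun x' => p t x' y) x)
          (nhdsWithin 0 (Set.Ioi 0)) (nhds L)
        ∧ HasDerivAt (fun s => p s x y) L t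
  upper : ∀ T : ℝ, 1 ≤ T → ∃ c : ℝ, 0 < c ∧ ∀ t : ℝ, 0 < t → t ≤ T →
      ∀ x y, p t x y ≤ c * t * Gfun d φ b β Φinv t (x - y)
  frac : ∀ T : ℝ, 1 ≤ T → ∃ c' : ℝ, 0 < c' ∧ ∀ ε : ℝ, 0 < ε → ε ≤ 1 →
      ∀ t : ℝ, 0 < t → t ≤ T → ∀ x y, x ≠ y →
      |Leps d κ J ε (fun x' => p t x' y) x| ≤ c' * Gtil d φ Φinv t (x - y)
  approx : ∀ f : EuclideanSpace ℝ (Fin d) → ℝ, (∃ M, ∀ x, |f x| ≤ M) →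
      UniformContinuous f → ∀ η : ℝ, 0 < η → ∃ t₀ : ℝ, 0 < t₀ ∧
      ∀ t : ℝ, 0 < t → t < t₀ → ∀ x, |(∫ y, p t x y * f y) - f x| ≤ η

section SecondDifference

variable {V : Type*} [NormedAddCommGroup V]

/-- A smooth substitute for the norm, with linear growth and bounded second differences. -/
noncomputable def japaneseBracket (x : V) : ℝ := Real.sqrt (1 + ‖x‖ ^ 2)

lemma japaneseBracket_sq (x : V) : japaneseBracket x ^ 2 = 1 + ‖x‖ ^ 2 :=
  Real.sq_sqrt (by positivity)

lemma japaneseBracket_nonneg (x : V) : 0 ≤ japaneseBracket x := Real.sqrt_nonneg _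

lemma one_le_japaneseBracket (x : V) : 1 ≤ japaneseBracket x := by
  have := japaneseBracket_sq x
  nlinarith [japaneseBracket_nonneg x, sq_nonneg ‖x‖]

lemma norm_le_japaneseBracket (x : V) : ‖x‖ ≤ japaneseBracket x :=
  Real.le_sqrt_of_sq_le (by linarith)

lemma abs_japaneseBracket_sub_le (x y : V) :
    |japaneseBracket x - japaneseBracket y| ≤ ‖x - y‖ := by
  refine le_trans ?_ (abs_norm_sub_norm_le x y)
  have hx := japaneseBracket_sq x
  have hy := japaneseBracket_sq y
  have h1 := norm_le_japaneseBracket x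
  have h2 := norm_le_japaneseBracket y
  have hpos : 0 < japaneseBracket x + japaneseBracket y := by
    linarith [one_le_japaneseBracket x, japaneseBracket_nonneg y]
  have key : |japaneseBracket x - japaneseBracket y| * (japaneseBracket x + japaneseBracket y)
      = |‖x‖ - ‖y‖| * (‖x‖ + ‖y‖) := by
    rw [← abs_of_pos hpos, ← abs_mul,
      ← abs_of_nonneg (add_nonneg (norm_nonneg x) (norm_nonneg y)), ← abs_mul]
    congr 1
    nlinarith
  have h3 : |‖x‖ - ‖y‖| * (‖x‖ + ‖y‖)
      ≤ |‖x‖ - ‖y‖| * (japaneseBracket x + japaneseBracket y) := by gcongr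
  exact le_of_mul_le_mul_right (key.le.trans h3) hpos

lemma continuous_japaneseBracket : Continuous (japaneseBracket : V → ℝ) := by
  unfold japaneseBracket; fun_prop

variable [InnerProductSpace ℝ V]

lemma japaneseBracket_second_difference_le (x z : V) :
    japaneseBracket (x + z) + japaneseBracket (x - z) - 2 * japaneseBracket x ≤ ‖z‖ ^ 2 := by
  have h1 := japaneseBracket_sq (x + z)
  have h2 := japaneseBracket_sq (x - z)
  have h3 := japaneseBracket_sq x
  have hpar := parallelogram_law_with_norm ℝ x z
  have hx := one_le_japaneseBracket x
  have hn : 0 ≤ ‖z‖ ^ 2 := by positivity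
  set P := japaneseBracket (x + z)
  set Q := japaneseBracket (x - z)
  set K := japaneseBracket x
  set n := ‖z‖ ^ 2
  have hle : (P + Q) ^ 2 ≤ (2 * K + n) ^ 2 := by
    nlinarith [sq_nonneg (P - Q), mul_nonneg hn (sub_nonneg.2 hx)]
  linarith [le_of_abs_le (abs_le_of_sq_le_sq hle (by linarith))]

/-- Inf-convolution: a bounded uniformly continuous function is a uniform limit of bounded
continuous functions whose second differences are bounded above quadratically. -/
lemma exists_semiconcave_approx {F : V → ℝ} {B : ℝ} (hB : ∀ x, |F x| ≤ B)
    (hF : UniformContinuous F) {η : ℝ} (hη : 0 < η) :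
    ∃ g : V → ℝ, Continuous g ∧ (∃ B', ∀ x, |g x| ≤ B') ∧
      (∃ A, 0 ≤ A ∧ ∀ x z, g (x + z) + g (x - z) - 2 * g x ≤ A * ‖z‖ ^ 2) ∧
      ∀ x, |F x - g x| ≤ η := by
  obtain ⟨r, hr, hrF⟩ := Metric.uniformContinuous_iff.1 hF η hη
  have hB0 : 0 ≤ B := (abs_nonneg _).trans (hB 0)
  set q : ℝ := Real.sqrt (1 + r ^ 2) - 1 with hq
  have hq0 : 0 < q := by
    have : (1 : ℝ) < Real.sqrt (1 + r ^ 2) := Real.lt_sqrt_of_sq_lt (by nlinarith)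
    linarith
  set A : ℝ := 2 * B / q with hA
  have hA0 : 0 ≤ A := by positivity
  have hAq : A * q = 2 * B := by rw [hA]; field_simp
  set G : V → V → ℝ := fun x y => F y + A * (japaneseBracket (x - y) - 1) with hG
  have hGlow : ∀ x y, -B ≤ G x y := fun x y => by
    have := (abs_le.1 (hB y)).1
    have h2 := mul_nonneg hA0 (sub_nonneg.2 (one_le_japaneseBracket (x - y)))
    simp only [hG]; linarith
  have hbdd : ∀ x, BddBelow (range (G x)) := fun x =>
    ⟨-B, by rintro _ ⟨y, rfl⟩; exact hGlow x y⟩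
  set g : V → ℝ := fun x => ⨅ y, G x y with hg
  have hgle : ∀ x y, g x ≤ G x y := fun x y => ciInf_le (hbdd x) y
  have hgF : ∀ x, g x ≤ F x := fun x => by
    refine (hgle x x).trans (le_of_eq ?_)
    simp [hG, japaneseBracket]
  have hgB : ∀ x, -B ≤ g x := fun x => le_ciInf (hGlow x)
  have hFg : ∀ x, F x - η ≤ g x := fun x => by
    refine le_ciInf fun y => ?_
    have hj := mul_nonneg hA0 (sub_nonneg.2 (one_le_japaneseBracket (x - y)))
    by_cases hxy : dist x y < r
    · have := (abs_lt.1 (Real.dist_eq (F x) (F y) ▸ hrF hxy)).2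
      simp only [hG]; linarith
    · have h1 : r ≤ ‖x - y‖ := by rw [← dist_eq_norm]; exact not_lt.1 hxy
      have h2 : q ≤ japaneseBracket (x - y) - 1 := by
        unfold japaneseBracket; rw [hq]; gcongr
      have h3 := mul_le_mul_of_nonneg_left h2 hA0
      have := (abs_le.1 (hB y)).1
      have := (abs_le.1 (hB x)).2
      simp only [hG]; linarith
  have hlip : ∀ x x', g x - g x' ≤ A * dist x x' := fun x x' => by
    have : g x - A * dist x x' ≤ g x' := by
      refine le_ciInf fun y => ?_
      have h1 := hgle x y
      have h2 := (abs_le.1 (abs_japaneseBracket_sub_le (x - y) (x' - y))).2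
      rw [sub_sub_sub_cancel_right, ← dist_eq_norm] at h2
      have h3 := mul_le_mul_of_nonneg_left h2 hA0
      simp only [hG] at h1 ⊢; linarith
    linarith
  refine ⟨g, ?_, ⟨B, fun x => abs_le.2 ⟨hgB x, (hgF x).trans (abs_le.1 (hB x)).2⟩⟩,
    ⟨A, hA0, fun x z => ?_⟩, fun x => abs_le.2 ⟨by linarith [hgF x], by linarith [hFg x]⟩⟩
  · refine (LipschitzWith.of_le_add_mul A.toNNReal fun x x' => ?_).continuous
    have := hlip x x'
    rw [Real.coe_toNNReal A hA0]; linarith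
  · have : (g (x + z) + g (x - z) - A * ‖z‖ ^ 2) / 2 ≤ g x := by
      refine le_ciInf fun y => ?_
      have h1 := hgle (x + z) y
      have h2 := hgle (x - z) y
      have h3 := mul_le_mul_of_nonneg_left (japaneseBracket_second_difference_le (x - y) z) hA0
      rw [show x - y + z = x + z - y by abel, show x - y - z = x - z - y by abel] at h3
      simp only [hG] at h1 h2 ⊢; linarith
    linarith

lemma second_difference_le_of_norm_fderiv_fderiv_le {k : V → ℝ} (hk : ContDiff ℝ 2 k) {M : ℝ}
    (hM : ∀ x, ‖fderiv ℝ (fderiv ℝ k) x‖ ≤ M) (x z : V) :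
    |k (x + z) + k (x - z) - 2 * k x| ≤ 2 * M * ‖z‖ ^ 2 := by
  have hdk : Differentiable ℝ k := hk.differentiable (by norm_num)
  have hddk : Differentiable ℝ (fderiv ℝ k) :=
    (hk.fderiv_right (m := 1) (by norm_num)).differentiable (by norm_num)
  have hlip : ∀ u v, ‖fderiv ℝ k u - fderiv ℝ k v‖ ≤ M * ‖u - v‖ := fun u v =>
    convex_univ.norm_image_sub_le_of_norm_fderiv_le (fun w _ => hddk w) (fun w _ => hM w)
      (mem_univ v) (mem_univ u)
  have hder : ∀ w ∈ Metric.closedBall (0 : V) ‖z‖,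
      HasFDerivWithinAt (fun w => k (x + w) + k (x - w))
        (fderiv ℝ k (x + w) - fderiv ℝ k (x - w)) (Metric.closedBall (0 : V) ‖z‖) w := by
    intro w _
    refine HasFDerivAt.hasFDerivWithinAt ?_
    have h1 := (hdk (x + w)).hasFDerivAt.comp w ((hasFDerivAt_id w).const_add x)
    have h2 := (hdk (x - w)).hasFDerivAt.comp w ((hasFDerivAt_id w).const_sub x)
    refine (h1.add h2).congr_fderiv ?_
    ext v
    simp [sub_eq_add_neg]
  have hM0 : 0 ≤ M := (norm_nonneg (fderiv ℝ (fderiv ℝ k) x)).trans (hM x)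
  have := (convex_closedBall (0 : V) ‖z‖).norm_image_sub_le_of_norm_hasFDerivWithin_le
    (C := 2 * M * ‖z‖) hder (fun w hw => by
      refine (hlip _ _).trans ?_
      rw [show x + w - (x - w) = (2 : ℝ) • w by rw [two_smul]; abel, norm_smul]
      rw [mem_closedBall_zero_iff] at hw
      norm_num
      nlinarith) (Metric.mem_closedBall_self (norm_nonneg z))
      (mem_closedBall_zero_iff.2 le_rfl : z ∈ _)
  simp only [add_zero, sub_zero, Real.norm_eq_abs] at this
  rw [show k (x + z) + k (x - z) - 2 * k x = k (x + z) + k (x - z) - (k x + k x) by ring]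
  linarith [sq ‖z‖]

end SecondDifference

section Generator

variable {d : ℕ} {φ J : ℝ → ℝ} {a₁ α₁ C₀ a b β : ℝ}
  {κ : EuclideanSpace ℝ (Fin d) → EuclideanSpace ℝ (Fin d) → ℝ} {κ₀ κ₁ κ₂ δ : ℝ}

lemma measurable_jump_norm (H : HKAssumptions d φ J a₁ α₁ C₀ a b β κ κ₀ κ₁ κ₂ δ) :
    Measurable fun z : EuclideanSpace ℝ (Fin d) => J ‖z‖ := by
  refine measurable_of_continuousOn_compl_singleton 0 ?_
  exact H.J_cont.comp continuous_norm.continuousOn fun z hz => norm_pos_iff.2 hz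

lemma scale_pos (H : HKAssumptions d φ J a₁ α₁ C₀ a b β κ κ₀ κ₁ κ₂ δ) {r : ℝ} (h0 : 0 < r)
    (h1 : r ≤ 1) : 0 < φ r := by
  have := H.φ_mono (left_mem_Icc.2 zero_le_one) ⟨h0.le, h1⟩ h0
  rwa [H.φ_zero] at this

lemma integrable_sq_mul_jump (H : HKAssumptions d φ J a₁ α₁ C₀ a b β κ κ₀ κ₁ κ₂ δ) :
    Integrable fun z : EuclideanSpace ℝ (Fin d) => ‖z‖ ^ 2 * J ‖z‖ := by
  have hd := H.hd
  have : Nonempty (Fin d) := ⟨⟨0, hd⟩⟩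
  have hiff := integrable_fun_norm_addHaar (volume : Measure (EuclideanSpace ℝ (Fin d)))
    (f := fun r => r ^ 2 * J r)
  rw [hiff, finrank_euclideanSpace_fin]
  have hmeas : ∀ s ⊆ Ioi (0 : ℝ), MeasurableSet s → AEStronglyMeasurable
      (fun y : ℝ => y ^ (d - 1) • (y ^ 2 * J y)) (volume.restrict s) := fun s hs hsm => by
    refine ContinuousOn.aestronglyMeasurable ?_ hsm
    exact (by fun_prop : Continuous fun y : ℝ => y ^ (d - 1)).continuousOn.smul
      ((by fun_prop : Continuous fun y : ℝ => y ^ 2).continuousOn.mul (H.J_cont.mono hs))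
  rw [← Ioc_union_Ioi_eq_Ioi (zero_le_one (α := ℝ))]
  refine IntegrableOn.union ?_ ?_
  · rw [integrableOn_Ioc_iff_integrableOn_Ioo]
    refine (H.hI.const_mul a).mono' (hmeas _ (fun y hy => hy.1) measurableSet_Ioo) ?_
    refine (ae_restrict_iff' measurableSet_Ioo).2 (ae_of_all _ fun r hr => ?_)
    have hφ := scale_pos H hr.1 hr.2.le
    have hJ := H.J_pos r hr.1
    have hr0 := hr.1
    rw [Real.norm_of_nonneg (by rw [smul_eq_mul]; positivity)]
    calc r ^ (d - 1) • (r ^ 2 * J r) ≤ r ^ (d - 1) * (r ^ 2 * (a / (r ^ d * φ r))) := by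
          rw [smul_eq_mul]; gcongr; exact H.hJ1_up r hr.1 hr.2.le
      _ = a * (r / φ r) := by
          obtain ⟨n, rfl⟩ : ∃ n, d = n + 1 := ⟨d - 1, by omega⟩
          simp only [Nat.add_sub_cancel, pow_succ]
          field_simp
  · have hint := (integrableOn_rpow_mul_exp_neg_mul_rpow (p := β) (s := (d + 1 : ℕ)) (b := b)
      (by have : (0 : ℝ) ≤ (d + 1 : ℕ) := by positivity
          linarith) H.β_pos H.hb).mono_set (Ioi_subset_Ioi zero_le_one)
    refine (hint.const_mul a).mono'
      (hmeas _ (Ioi_subset_Ioi zero_le_one) measurableSet_Ioi) ?_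
    refine (ae_restrict_iff' measurableSet_Ioi).2 (ae_of_all _ fun r hr => ?_)
    have hr0 : 0 < r := zero_lt_one.trans hr
    have hJ := H.J_pos r hr0
    rw [Real.norm_of_nonneg (by rw [smul_eq_mul]; positivity), Real.rpow_natCast]
    calc r ^ (d - 1) • (r ^ 2 * J r)
        ≤ r ^ (d - 1) * (r ^ 2 * (a * Real.exp (-b * r ^ β))) := by
          rw [smul_eq_mul]; gcongr; exact H.hJ1_exp r hr
      _ = a * (r ^ (d + 1) * Real.exp (-b * r ^ β)) := by
          obtain ⟨n, rfl⟩ : ∃ n, d = n + 1 := ⟨d - 1, by omega⟩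
          simp only [Nat.add_sub_cancel, pow_succ]
          ring

lemma sq_mul_jump_nonneg (H : HKAssumptions d φ J a₁ α₁ C₀ a b β κ κ₀ κ₁ κ₂ δ)
    (z : EuclideanSpace ℝ (Fin d)) : 0 ≤ ‖z‖ ^ 2 * J ‖z‖ := by
  rcases eq_or_ne z 0 with rfl | hz
  · simp
  · have := H.J_pos ‖z‖ (norm_pos_iff.2 hz)
    positivity

lemma measurable_jump_kernel (H : HKAssumptions d φ J a₁ α₁ C₀ a b β κ κ₀ κ₁ κ₂ δ)
    (x : EuclideanSpace ℝ (Fin d)) : Measurable fun z => κ x z * J ‖z‖ :=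
  (H.κ_meas.comp (measurable_const.prodMk measurable_id)).mul (measurable_jump_norm H)

lemma norm_mul_jump_kernel_le (H : HKAssumptions d φ J a₁ α₁ C₀ a b β κ κ₀ κ₁ κ₂ δ)
    {m : ℝ} {A : ℝ} {x z : EuclideanSpace ℝ (Fin d)} (h : |m| ≤ A * ‖z‖ ^ 2) :
    ‖m * (κ x z * J ‖z‖)‖ ≤ A * κ₁ * (‖z‖ ^ 2 * J ‖z‖) := by
  rcases eq_or_ne z 0 with rfl | hz
  · have : m = 0 := by simpa using h
    simp [this]
  · have hJ := H.J_pos ‖z‖ (norm_pos_iff.2 hz)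
    have hκ0 : 0 ≤ κ x z := H.κ₀_pos.le.trans (H.κ_low x z)
    rw [norm_mul, Real.norm_eq_abs, Real.norm_of_nonneg (by positivity)]
    calc |m| * (κ x z * J ‖z‖) ≤ (A * ‖z‖ ^ 2) * (κ₁ * J ‖z‖) := by
          gcongr
          · exact (abs_nonneg _).trans h
          · exact H.κ_up x z
      _ = _ := by ring

lemma integrableOn_mul_jump_kernel (H : HKAssumptions d φ J a₁ α₁ C₀ a b β κ κ₀ κ₁ κ₂ δ)
    {k : EuclideanSpace ℝ (Fin d) → ℝ} (hk : Measurable k) {A : ℝ}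
    {s : Set (EuclideanSpace ℝ (Fin d))} (hs : MeasurableSet s)
    (h : ∀ z ∈ s, |k z| ≤ A * ‖z‖ ^ 2) (x : EuclideanSpace ℝ (Fin d)) :
    IntegrableOn (fun z => k z * (κ x z * J ‖z‖)) s := by
  refine (((integrable_sq_mul_jump H).const_mul (A * κ₁)).integrableOn).mono'
    (hk.mul (measurable_jump_kernel H x)).aestronglyMeasurable ?_
  exact (ae_restrict_iff' hs).2 (ae_of_all _ fun z hz => norm_mul_jump_kernel_le H (h z hz))

lemma measurableSet_lt_norm (ε : ℝ) :
    MeasurableSet {z : EuclideanSpace ℝ (Fin d) | ε < ‖z‖} :=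
  measurableSet_lt measurable_const measurable_norm

lemma Leps_eq_half_second_difference (H : HKAssumptions d φ J a₁ α₁ C₀ a b β κ κ₀ κ₁ κ₂ δ)
    {f : EuclideanSpace ℝ (Fin d) → ℝ} (hf : Continuous f) {ε A : ℝ}
    {x : EuclideanSpace ℝ (Fin d)} (h : ∀ z, ε < ‖z‖ → |f (x + z) - f x| ≤ A * ‖z‖ ^ 2) :
    Leps d κ J ε f x = 1 / 2 * ∫ z in {z : EuclideanSpace ℝ (Fin d) | ε < ‖z‖},
      (f (x + z) + f (x - z) - 2 * f x) * (κ x z * J ‖z‖) := by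
  have hm : Measurable fun z => f (x + z) - f x := by fun_prop
  have hm' : Measurable fun z => f (x - z) - f x := by fun_prop
  have hi := integrableOn_mul_jump_kernel H hm (measurableSet_lt_norm ε) h x
  have hi' := integrableOn_mul_jump_kernel H hm' (measurableSet_lt_norm ε)
    (fun z hz => by simpa [sub_eq_add_neg] using h (-z) (by simpa using hz)) x
  have hsymm : ∫ z in {z : EuclideanSpace ℝ (Fin d) | ε < ‖z‖},
      (f (x - z) - f x) * (κ x z * J ‖z‖) = Leps d κ J ε f x := by
    rw [Leps, ← integral_indicator (measurableSet_lt_norm ε),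
      ← integral_indicator (measurableSet_lt_norm ε), ← integral_neg_eq_self]
    congr 1
    ext z
    simp only [indicator, mem_ofPred_eq, norm_neg, sub_neg_eq_add, ← H.κ_sym x z]
  have hadd := integral_add hi hi'
  rw [hsymm, ← Leps] at hadd
  rw [show Leps d κ J ε f x = 1 / 2 * (Leps d κ J ε f x + Leps d κ J ε f x) by ring, ← hadd]
  congr 2
  ext z
  ring

/-- The operator `L^κ` written as an absolutely convergent integral of second differences. -/
noncomputable def symmGenerator (κ : EuclideanSpace ℝ (Fin d) → EuclideanSpace ℝ (Fin d) → ℝ)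
    (J : ℝ → ℝ) (f : EuclideanSpace ℝ (Fin d) → ℝ) (x : EuclideanSpace ℝ (Fin d)) : ℝ :=
  1 / 2 * ∫ z, (f (x + z) + f (x - z) - 2 * f x) * (κ x z * J ‖z‖)

lemma symmGenerator_neg (f : EuclideanSpace ℝ (Fin d) → ℝ) (x : EuclideanSpace ℝ (Fin d)) :
    symmGenerator κ J (fun y => -f y) x = -symmGenerator κ J f x := by
  rw [symmGenerator, symmGenerator, ← mul_neg, ← integral_neg]
  congr 2
  ext z
  ring

lemma abs_sub_le_of_bounded {f : EuclideanSpace ℝ (Fin d) → ℝ} {M : ℝ} (hM : ∀ x, |f x| ≤ M)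
    {ε : ℝ} (hε : 0 < ε) (x z : EuclideanSpace ℝ (Fin d)) (hz : ε < ‖z‖) :
    |f (x + z) - f x| ≤ 2 * M / ε ^ 2 * ‖z‖ ^ 2 := by
  have hM0 : 0 ≤ M := (abs_nonneg _).trans (hM 0)
  calc |f (x + z) - f x| ≤ |f (x + z)| + |f x| := abs_sub _ _
    _ ≤ 2 * M / ε ^ 2 * ε ^ 2 := by
        rw [div_mul_cancel₀ _ (by positivity)]; linarith [hM (x + z), hM x]
    _ ≤ _ := by gcongr

lemma tendsto_Leps_symmGenerator (H : HKAssumptions d φ J a₁ α₁ C₀ a b β κ κ₀ κ₁ κ₂ δ)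
    {f : EuclideanSpace ℝ (Fin d) → ℝ} (hf : Continuous f) {M A : ℝ} (hM : ∀ x, |f x| ≤ M)
    (hA : ∀ x z, |f (x + z) + f (x - z) - 2 * f x| ≤ A * ‖z‖ ^ 2)
    (x : EuclideanSpace ℝ (Fin d)) :
    Tendsto (fun ε => Leps d κ J ε f x) (nhdsWithin 0 (Ioi 0))
      (nhds (symmGenerator κ J f x)) := by
  have heq : ∀ᶠ ε in nhdsWithin (0 : ℝ) (Ioi 0),
      1 / 2 * ∫ z, {z : EuclideanSpace ℝ (Fin d) | ε < ‖z‖}.indicator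
        (fun z => (f (x + z) + f (x - z) - 2 * f x) * (κ x z * J ‖z‖)) z
        = Leps d κ J ε f x := by
    filter_upwards [self_mem_nhdsWithin] with ε hε
    rw [integral_indicator (measurableSet_lt_norm ε),
      Leps_eq_half_second_difference H hf (abs_sub_le_of_bounded hM hε x)]
  refine Tendsto.congr' heq (Tendsto.const_mul _ ?_)
  have hmeas : Measurable fun z => (f (x + z) + f (x - z) - 2 * f x) * (κ x z * J ‖z‖) :=
    (by fun_prop : Measurable fun z => f (x + z) + f (x - z) - 2 * f x).mul
      (measurable_jump_kernel H x)
  refine tendsto_integral_filter_of_dominated_convergence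
    (fun z => A * κ₁ * (‖z‖ ^ 2 * J ‖z‖)) ?_ ?_ ((integrable_sq_mul_jump H).const_mul _) ?_
  · exact Eventually.of_forall fun ε =>
      (hmeas.indicator (measurableSet_lt_norm ε)).aestronglyMeasurable
  · exact Eventually.of_forall fun ε => ae_of_all _ fun z =>
      (norm_indicator_le_norm_self _ z).trans (norm_mul_jump_kernel_le H (hA x z))
  · refine ae_of_all _ fun z => ?_
    rcases eq_or_ne z 0 with rfl | hz
    · refine tendsto_const_nhds.congr fun ε => ?_
      simp [indicator, ← two_mul]
    · refine tendsto_const_nhds.congr' ?_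
      filter_upwards [Ioo_mem_nhdsGT (norm_pos_iff.2 hz)] with ε hε
      rw [indicator_of_mem (show z ∈ {z | ε < ‖z‖} from hε.2)]

lemma abs_symmGenerator_le (H : HKAssumptions d φ J a₁ α₁ C₀ a b β κ κ₀ κ₁ κ₂ δ)
    {f : EuclideanSpace ℝ (Fin d) → ℝ} {A : ℝ} {x : EuclideanSpace ℝ (Fin d)}
    (hA : ∀ z, |f (x + z) + f (x - z) - 2 * f x| ≤ A * ‖z‖ ^ 2) :
    |symmGenerator κ J f x| ≤
      A * κ₁ * ∫ z : EuclideanSpace ℝ (Fin d), ‖z‖ ^ 2 * J ‖z‖ := by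
  have h := norm_integral_le_of_norm_le ((integrable_sq_mul_jump H).const_mul (A * κ₁))
    (ae_of_all _ fun z => norm_mul_jump_kernel_le H (x := x) (hA z))
  rw [integral_const_mul, Real.norm_eq_abs] at h
  rw [symmGenerator, abs_mul, abs_of_pos (by norm_num : (0 : ℝ) < 1 / 2)]
  linarith [(abs_nonneg _).trans h]

lemma abs_symmGenerator_sub_le (H : HKAssumptions d φ J a₁ α₁ C₀ a b β κ κ₀ κ₁ κ₂ δ)
    {f : EuclideanSpace ℝ (Fin d) → ℝ} (hf : Continuous f) {A B : ℝ}
    {x y : EuclideanSpace ℝ (Fin d)}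
    (hA : ∀ x z, |f (x + z) + f (x - z) - 2 * f x| ≤ A * ‖z‖ ^ 2)
    (hB : ∀ z, |(f (x + z) + f (x - z) - 2 * f x) - (f (y + z) + f (y - z) - 2 * f y)|
      ≤ B * ‖z‖ ^ 2) :
    |symmGenerator κ J f x - symmGenerator κ J f y| ≤
      (B * κ₁ + A * (κ₂ * ‖x - y‖ ^ δ)) *
        ∫ z : EuclideanSpace ℝ (Fin d), ‖z‖ ^ 2 * J ‖z‖ := by
  have hint : ∀ x, Integrable fun z =>
      (f (x + z) + f (x - z) - 2 * f x) * (κ x z * J ‖z‖) := fun x => by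
    rw [← integrableOn_univ]
    exact integrableOn_mul_jump_kernel H (by fun_prop) MeasurableSet.univ (fun z _ => hA x z) x
  have h := norm_integral_le_of_norm_le
    (f := fun z => (f (x + z) + f (x - z) - 2 * f x) * (κ x z * J ‖z‖)
      - (f (y + z) + f (y - z) - 2 * f y) * (κ y z * J ‖z‖))
    ((integrable_sq_mul_jump H).const_mul (B * κ₁ + A * (κ₂ * ‖x - y‖ ^ δ)))
    (ae_of_all _ fun z => by
      have h1 := norm_mul_jump_kernel_le H (x := x) (hB z)
      have h2 : ‖(f (y + z) + f (y - z) - 2 * f y) * ((κ x z - κ y z) * J ‖z‖)‖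
          ≤ A * (κ₂ * ‖x - y‖ ^ δ) * (‖z‖ ^ 2 * J ‖z‖) := by
        rcases eq_or_ne z 0 with rfl | hz
        · simp [← two_mul]
        · have hJ := H.J_pos ‖z‖ (norm_pos_iff.2 hz)
          rw [norm_mul, norm_mul, Real.norm_of_nonneg hJ.le, Real.norm_eq_abs, Real.norm_eq_abs]
          calc _ ≤ (A * ‖z‖ ^ 2) * ((κ₂ * ‖x - y‖ ^ δ) * J ‖z‖) := by
                gcongr
                · exact (abs_nonneg _).trans (hA y z)
                · exact hA y z
                · exact H.κ_holder x y z
            _ = _ := by ring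
      rw [show (f (x + z) + f (x - z) - 2 * f x) * (κ x z * J ‖z‖)
          - (f (y + z) + f (y - z) - 2 * f y) * (κ y z * J ‖z‖)
          = (f (x + z) + f (x - z) - 2 * f x - (f (y + z) + f (y - z) - 2 * f y))
              * (κ x z * J ‖z‖)
            + (f (y + z) + f (y - z) - 2 * f y) * ((κ x z - κ y z) * J ‖z‖) by ring,
        add_mul]
      exact (norm_add_le _ _).trans (add_le_add h1 h2))
  rw [integral_const_mul, Real.norm_eq_abs, integral_sub (hint x) (hint y)] at h
  rw [symmGenerator, symmGenerator, ← mul_sub, abs_mul,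
    abs_of_pos (by norm_num : (0 : ℝ) < 1 / 2)]
  linarith [(abs_nonneg _).trans h]

lemma uniformContinuous_symmGenerator (H : HKAssumptions d φ J a₁ α₁ C₀ a b β κ κ₀ κ₁ κ₂ δ)
    {f : EuclideanSpace ℝ (Fin d) → ℝ} (hf : Continuous f) {A B ε₀ : ℝ} (hε₀ : 0 < ε₀)
    (hA : ∀ x z, |f (x + z) + f (x - z) - 2 * f x| ≤ A * ‖z‖ ^ 2)
    (hB : ∀ x y z, |(f (x + z) + f (x - z) - 2 * f x) - (f (y + z) + f (y - z) - 2 * f y)|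
      ≤ B * ‖x - y‖ ^ ε₀ * ‖z‖ ^ 2) :
    UniformContinuous (symmGenerator κ J f) := by
  set I := ∫ z : EuclideanSpace ℝ (Fin d), ‖z‖ ^ 2 * J ‖z‖
  have hmod : Tendsto (fun r : ℝ => (B * r ^ ε₀ * κ₁ + A * (κ₂ * r ^ δ)) * I) (nhds 0)
      (nhds 0) := by
    have hc : Continuous fun r : ℝ => (B * r ^ ε₀ * κ₁ + A * (κ₂ * r ^ δ)) * I := by
      have h1 := Real.continuous_rpow_const hε₀.le
      have h2 := Real.continuous_rpow_const H.δ_pos.le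
      fun_prop
    have := hc.tendsto 0
    simpa [Real.zero_rpow hε₀.ne', Real.zero_rpow H.δ_pos.ne'] using this
  refine Metric.uniformContinuous_iff.2 fun η hη => ?_
  obtain ⟨r, hr, hrη⟩ := Metric.eventually_nhds_iff.1 (hmod.eventually (gt_mem_nhds hη))
  refine ⟨r, hr, fun {x y} hxy => ?_⟩
  rw [Real.dist_eq]
  refine (abs_symmGenerator_sub_le H hf hA (hB x y)).trans_lt (hrη ?_)
  simpa [dist_eq_norm] using hxy

end Generator

section Kernel

variable {d : ℕ} {φ J : ℝ → ℝ} {a₁ α₁ C₀ a b β : ℝ}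
  {κ : EuclideanSpace ℝ (Fin d) → EuclideanSpace ℝ (Fin d) → ℝ} {κ₀ κ₁ κ₂ δ : ℝ}
  {Φinv : ℝ → ℝ} {p : ℝ → EuclideanSpace ℝ (Fin d) → EuclideanSpace ℝ (Fin d) → ℝ}

lemma integrableOn_div_scale (H : HKAssumptions d φ J a₁ α₁ C₀ a b β κ κ₀ κ₁ κ₂ δ) {r : ℝ}
    (hr1 : r ≤ 1) : IntegrableOn (fun s => s / φ s) (Ioo 0 r) :=
  H.hI.mono_set (Ioo_subset_Ioo_right hr1)

lemma sq_div_scale_le_integral (H : HKAssumptions d φ J a₁ α₁ C₀ a b β κ κ₀ κ₁ κ₂ δ) {r : ℝ}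
    (hr : 0 < r) (hr1 : r ≤ 1) : r ^ 2 / (2 * φ r) ≤ ∫ s in Ioo 0 r, s / φ s := by
  have hφ := scale_pos H hr hr1
  have hlin : ∫ s in Ioo 0 r, s / φ r = r ^ 2 / (2 * φ r) := by
    rw [← integral_Ioc_eq_integral_Ioo, ← intervalIntegral.integral_of_le hr.le,
      intervalIntegral.integral_div, integral_id]
    field_simp
    ring
  rw [← hlin]
  refine setIntegral_mono_on ?_ (integrableOn_div_scale H hr1) measurableSet_Ioo fun s hs => ?_
  · exact ((by fun_prop : Continuous fun s : ℝ => s / φ r).integrableOn_Icc).mono_set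
      Ioo_subset_Icc_self
  · have hs1 := hs.2.le.trans hr1
    have hφs := scale_pos H hs.1 hs1
    have hle := H.φ_mono.monotoneOn ⟨hs.1.le, hs1⟩ ⟨hr.le, hr1⟩ hs.2.le
    have := hs.1.le
    gcongr

lemma integral_div_scale_pos (H : HKAssumptions d φ J a₁ α₁ C₀ a b β κ κ₀ κ₁ κ₂ δ) {r : ℝ}
    (hr : 0 < r) (hr1 : r ≤ 1) : 0 < ∫ s in Ioo 0 r, s / φ s := by
  have hφ := scale_pos H hr hr1
  exact lt_of_lt_of_le (by positivity) (sq_div_scale_le_integral H hr hr1)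

lemma Phi_le_scale (H : HKAssumptions d φ J a₁ α₁ C₀ a b β κ κ₀ κ₁ κ₂ δ) {r : ℝ}
    (hr : 0 < r) (hr1 : r ≤ 1) : Phi φ r ≤ φ r := by
  have hφ := scale_pos H hr hr1
  have hI := integral_div_scale_pos H hr hr1
  have h := sq_div_scale_le_integral H hr hr1
  rw [Phi, if_pos hr1, div_le_iff₀ (by positivity)]
  rw [div_le_iff₀ (by positivity)] at h
  linarith

lemma const_pos (H : HKAssumptions d φ J a₁ α₁ C₀ a b β κ κ₀ κ₁ κ₂ δ) : 0 < C₀ :=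
  H.hC₀ ▸ integral_div_scale_pos H one_pos le_rfl

lemma sq_div_le_Phi (H : HKAssumptions d φ J a₁ α₁ C₀ a b β κ κ₀ κ₁ κ₂ δ) {r : ℝ}
    (hr : 0 < r) : r ^ 2 / (2 * C₀) ≤ Phi φ r := by
  by_cases hr1 : r ≤ 1
  · have hI := integral_div_scale_pos H hr hr1
    rw [Phi, if_pos hr1, H.hC₀]
    gcongr
    · refine (ae_restrict_iff' measurableSet_Ioo).2 (ae_of_all _ fun s hs => ?_)
      exact div_nonneg hs.1.le (scale_pos H hs.1 hs.2.le).le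
    · exact H.hI
  · rw [Phi, if_neg hr1, ← H.hC₀]
    exact le_of_eq (by ring)

lemma exists_lower_bound_Phi_inv (H : HKAssumptions d φ J a₁ α₁ C₀ a b β κ κ₀ κ₁ κ₂ δ)
    (HΦ : PhiInvSpec φ Φinv) {t₁ : ℝ} (ht₁ : 0 < t₁) :
    ∃ ρ, 0 < ρ ∧ ∀ s, t₁ ≤ s → ρ ≤ Φinv s := by
  have hc := H.φ_cont 0 (left_mem_Icc.2 zero_le_one)
  rw [ContinuousWithinAt, H.φ_zero, Metric.tendsto_nhdsWithin_nhds] at hc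
  obtain ⟨ρ, hρ, hφ⟩ := hc t₁ ht₁
  refine ⟨min ρ 1, lt_min hρ one_pos, fun s hs => ?_⟩
  by_contra hlt
  have hpos := HΦ.pos s (ht₁.trans_le hs)
  have h1 : Φinv s < ρ := (not_le.1 hlt).trans_le (min_le_left _ _)
  have h2 : Φinv s ≤ 1 := ((not_le.1 hlt).trans_le (min_le_right _ _)).le
  have h3 := hφ ⟨hpos.le, h2⟩ (by rwa [Real.dist_eq, sub_zero, abs_of_pos hpos])
  rw [Real.dist_eq, sub_zero] at h3
  have h4 := Phi_le_scale H hpos h2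
  rw [HΦ.right_inv s (ht₁.trans_le hs)] at h4
  linarith [le_abs_self (φ (Φinv s))]

lemma Gtil_le_near (t : ℝ) (x : EuclideanSpace ℝ (Fin d)) :
    Gtil d φ Φinv t x ≤ 1 / (t * Φinv t ^ d) := by
  unfold Gtil
  split_ifs
  · exact le_rfl
  · exact min_le_left _ _

lemma Gfun_le_near (t : ℝ) (x : EuclideanSpace ℝ (Fin d)) :
    Gfun d φ b β Φinv t x ≤ 1 / (t * Φinv t ^ d) := by
  unfold Gfun
  split_ifs
  · exact le_rfl
  · exact min_le_left _ _

lemma Gtil_le_far (H : HKAssumptions d φ J a₁ α₁ C₀ a b β κ κ₀ κ₁ κ₂ δ) (t : ℝ)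
    {x : EuclideanSpace ℝ (Fin d)} (hx : x ≠ 0) :
    Gtil d φ Φinv t x ≤ 2 * C₀ / ‖x‖ ^ (d + 2) := by
  have hn : 0 < ‖x‖ := norm_pos_iff.2 hx
  have hC := const_pos H
  rw [Gtil, if_neg hx]
  refine (min_le_right _ _).trans ?_
  calc 1 / (‖x‖ ^ d * Phi φ ‖x‖) ≤ 1 / (‖x‖ ^ d * (‖x‖ ^ 2 / (2 * C₀))) := by
        gcongr; exact sq_div_le_Phi H hn
    _ = _ := by rw [pow_add]; field_simp

/-- An integrable profile decaying like `‖x‖ ^ (-(d + 2))`. -/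
noncomputable def decayProfile (x : EuclideanSpace ℝ (Fin d)) : ℝ := ((1 + ‖x‖) ^ (d + 2))⁻¹

lemma integrable_decayProfile :
    Integrable (decayProfile : EuclideanSpace ℝ (Fin d) → ℝ) := by
  have h := integrable_one_add_norm (μ := (volume : Measure (EuclideanSpace ℝ (Fin d))))
    (r := ((d + 2 : ℕ) : ℝ)) (by rw [finrank_euclideanSpace_fin]; push_cast; linarith)
  refine h.congr (ae_of_all _ fun x => ?_)
  simp only [decayProfile]
  rw [Real.rpow_neg (by positivity), Real.rpow_natCast]

lemma le_decayProfile {x : EuclideanSpace ℝ (Fin d)} {m S K : ℝ} (hS : 0 ≤ S) (hK : 0 ≤ K)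
    (hnear : ‖x‖ ≤ 2 → m ≤ S) (hfar : 2 < ‖x‖ → m ≤ K / ((1 + ‖x‖) / 3) ^ (d + 2)) :
    m ≤ 3 ^ (d + 2) * (S + K) * decayProfile x := by
  have hpos : (0 : ℝ) < (1 + ‖x‖) ^ (d + 2) := by positivity
  rw [decayProfile, ← div_eq_mul_inv, le_div_iff₀ hpos]
  rcases le_or_gt ‖x‖ 2 with h | h
  · have h3 : (1 + ‖x‖) ^ (d + 2) ≤ 3 ^ (d + 2) := by gcongr; linarith
    calc m * (1 + ‖x‖) ^ (d + 2) ≤ S * (1 + ‖x‖) ^ (d + 2) := by gcongr; exact hnear h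
      _ ≤ (S + K) * 3 ^ (d + 2) := by gcongr; linarith
      _ = _ := by ring
  · have := hfar h
    rw [div_pow, div_div_eq_mul_div, le_div_iff₀ hpos] at this
    refine this.trans ?_
    have : (0 : ℝ) ≤ 3 ^ (d + 2) * S := by positivity
    linarith

lemma kernel_deriv_bounds (hp : GoodHeatKernel d φ J b β Φinv κ p) :
    ∃ c, 0 < c ∧ ∀ t, 0 < t → t ≤ 1 → ∀ x y : EuclideanSpace ℝ (Fin d), x ≠ y →
      HasDerivAt (fun s => p s x y) (deriv (fun s => p s x y) t) t ∧
      Tendsto (fun ε => Leps d κ J ε (fun x' => p t x' y) x) (nhdsWithin 0 (Ioi 0))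
        (nhds (deriv (fun s => p s x y) t)) ∧
      (∀ ε, 0 < ε → ε ≤ 1 →
        |Leps d κ J ε (fun x' => p t x' y) x| ≤ c * Gtil d φ Φinv t (x - y)) ∧
      |deriv (fun s => p s x y) t| ≤ c * Gtil d φ Φinv t (x - y) := by
  obtain ⟨c, hc, hfrac⟩ := hp.frac 1 le_rfl
  refine ⟨c, hc, fun t ht ht1 x y hxy => ?_⟩
  obtain ⟨L, hL, hd⟩ := hp.eqn t ht x y hxy
  rw [hd.deriv]
  refine ⟨hd, hL, fun ε h0 h1 => hfrac ε h0 h1 t ht ht1 x y hxy, ?_⟩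
  refine le_of_tendsto hL.abs ?_
  filter_upwards [Ioo_mem_nhdsGT (one_pos (α := ℝ))] with ε hε
  exact hfrac ε hε.1 hε.2.le t ht ht1 x y hxy

lemma continuous_kernel (hp : GoodHeatKernel d φ J b β Φinv κ p) {t : ℝ} (ht : 0 < t) :
    Continuous fun q : EuclideanSpace ℝ (Fin d) × EuclideanSpace ℝ (Fin d) => p t q.1 q.2 := by
  rw [← continuousOn_univ]
  exact hp.cont.comp (f := fun q : EuclideanSpace ℝ (Fin d) × EuclideanSpace ℝ (Fin d) => (t, q))
    (by fun_prop) fun q _ => ⟨ht, mem_univ _⟩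

lemma continuous_kernel_right (hp : GoodHeatKernel d φ J b β Φinv κ p) {t : ℝ} (ht : 0 < t)
    (x : EuclideanSpace ℝ (Fin d)) : Continuous (p t x) :=
  (continuous_kernel hp ht).comp (by fun_prop : Continuous fun y => (x, y))

/-- Away from the diagonal the kernel is Lipschitz in time and vanishes at time zero. -/
lemma exists_abs_kernel_le (H : HKAssumptions d φ J a₁ α₁ C₀ a b β κ κ₀ κ₁ κ₂ δ)
    (hp : GoodHeatKernel d φ J b β Φinv κ p) :
    ∃ K, 0 < K ∧ ∀ t, 0 < t → t ≤ 1 → ∀ x y : EuclideanSpace ℝ (Fin d), x ≠ y →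
      |p t x y| ≤ K / ‖x - y‖ ^ (d + 2) := by
  obtain ⟨c, hc, hder⟩ := kernel_deriv_bounds hp
  have hC := const_pos H
  set K := c * (2 * C₀) with hK
  have hK0 : 0 < K := by positivity
  have hlip : ∀ x y : EuclideanSpace ℝ (Fin d), x ≠ y → ∀ s t, 0 < s → s ≤ t → t ≤ 1 →
      |p t x y - p s x y| ≤ K / ‖x - y‖ ^ (d + 2) * (t - s) := by
    intro x y hxy s t hs hst ht1
    have h := (convex_Icc s t).norm_image_sub_le_of_norm_hasDerivWithin_le
      (f := fun s => p s x y) (f' := fun s => deriv (fun s => p s x y) s)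
      (C := K / ‖x - y‖ ^ (d + 2))
      (fun r hr => (hder r (hs.trans_le hr.1) (hr.2.trans ht1) x y hxy).1.hasDerivWithinAt)
      (fun r hr => by
        refine (hder r (hs.trans_le hr.1) (hr.2.trans ht1) x y hxy).2.2.2.trans ?_
        refine (mul_le_mul_of_nonneg_left (Gtil_le_far H r (sub_ne_zero.2 hxy)) hc.le).trans ?_
        exact le_of_eq (by rw [hK]; ring))
      (left_mem_Icc.2 hst) (right_mem_Icc.2 hst)
    rwa [Real.norm_eq_abs, Real.norm_eq_abs, abs_of_nonneg (sub_nonneg.2 hst)] at h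
  have key : ∀ e : ℝ, |e| = 1 → ∀ t, 0 < t → t ≤ 1 → ∀ x y : EuclideanSpace ℝ (Fin d), x ≠ y →
      e * p t x y ≤ K / ‖x - y‖ ^ (d + 2) * t := by
    intro e he t ht ht1 x y₀ hxy
    by_contra hcon
    set q : EuclideanSpace ℝ (Fin d) → ℝ :=
      fun y => e * p t x y - K / ‖x - y‖ ^ (d + 2) * t with hq
    have hn0 : 0 < ‖x - y₀‖ := norm_pos_iff.2 (sub_ne_zero.2 hxy)
    have hq0 : 0 < q y₀ := sub_pos.2 (not_le.1 hcon)
    have hqc : ContinuousAt q y₀ := by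
      have h1 := (continuous_kernel_right hp ht x).continuousAt (x := y₀)
      refine (continuousAt_const.mul h1).sub (ContinuousAt.mul (ContinuousAt.div ?_ ?_ ?_) ?_)
      · exact continuousAt_const
      · fun_prop
      · positivity
      · exact continuousAt_const
    obtain ⟨r', hr', hball⟩ := Metric.eventually_nhds_iff.1
      (hqc.eventually (lt_mem_nhds (half_lt_self hq0)))
    set r := min r' ‖x - y₀‖
    have hr : 0 < r := lt_min hr' hn0
    let χ : ContDiffBump y₀ := ⟨r / 2, r, half_pos hr, half_lt_self hr⟩
    have hχx : χ x = 0 := χ.zero_of_le_dist (by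
      change r ≤ dist x y₀
      rw [dist_eq_norm]; exact min_le_right _ _)
    have hχc : Continuous χ := χ.continuous
    have hχs : HasCompactSupport χ := χ.hasCompactSupport
    have hχpos : 0 < ∫ y, χ y := χ.integral_pos
    obtain ⟨t₀, ht₀, happ⟩ := hp.approx χ
      ⟨1, fun y => by rw [abs_of_nonneg χ.nonneg]; exact χ.le_one⟩
      (hχc.uniformContinuous_of_tendsto_cocompact hχs.is_zero_at_infty)
      (q y₀ / 2 * (∫ y, χ y) / 2) (by positivity)
    set s := min t t₀ / 2 with hs
    have hmin : 0 < min t t₀ := lt_min ht ht₀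
    have hs0 : 0 < s := half_pos hmin
    have hst : s < t := (half_lt_self hmin).trans_le (min_le_left _ _)
    have hst₀ : s < t₀ := (half_lt_self hmin).trans_le (min_le_right _ _)
    have h1 := happ s hs0 hst₀ x
    rw [hχx, sub_zero] at h1
    have hint : Integrable fun y => p s x y * χ y :=
      ((continuous_kernel_right hp hs0 x).mul hχc).integrable_of_hasCompactSupport hχs.mul_left
    have h2 : q y₀ / 2 * ∫ y, χ y ≤ e * ∫ y, p s x y * χ y := by
      rw [← integral_const_mul, ← integral_const_mul]
      refine integral_mono ((hχc.integrable_of_hasCompactSupport hχs).const_mul _)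
        (hint.const_mul _) fun y => ?_
      by_cases hy : dist y y₀ < r
      · have hxy' : x ≠ y := by
          rintro rfl
          rw [dist_eq_norm] at hy
          exact absurd hy (not_lt.2 (min_le_right _ _))
        have h3 : q y₀ / 2 < q y := hball (hy.trans_le (min_le_left _ _))
        have h4 := hlip x y hxy' s t hs0 hst.le ht1
        have h5 : e * (p t x y - p s x y) ≤ |p t x y - p s x y| := by
          refine (le_abs_self _).trans ?_
          rw [abs_mul, he, one_mul]
        have h6 : 0 ≤ K / ‖x - y‖ ^ (d + 2) * s := by positivity
        have h7 : q y₀ / 2 ≤ e * p s x y := by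
          simp only [hq] at h3 ⊢; nlinarith
        have := mul_le_mul_of_nonneg_right h7 (χ.nonneg (x := y))
        simpa [mul_assoc] using this
      · have : χ y = 0 := χ.zero_of_le_dist (not_lt.1 hy)
        simp [this]
    have h3 : e * ∫ y, p s x y * χ y ≤ |∫ y, p s x y * χ y| := by
      refine (le_abs_self _).trans ?_
      rw [abs_mul, he, one_mul]
    have h4 : 0 < q y₀ / 2 * ∫ y, χ y := by positivity
    linarith
  refine ⟨K, hK0, fun t ht ht1 x y hxy => ?_⟩
  have hle : K / ‖x - y‖ ^ (d + 2) * t ≤ K / ‖x - y‖ ^ (d + 2) :=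
    mul_le_of_le_one_right (by positivity) ht1
  have h1 := key 1 (by simp) t ht ht1 x y hxy
  have h2 := key (-1) (by simp) t ht ht1 x y hxy
  exact abs_le.2 ⟨by linarith, by linarith⟩

lemma exists_integrable_kernel (hp : GoodHeatKernel d φ J b β Φinv κ p) :
    ∃ t₀, 0 < t₀ ∧ t₀ ≤ 1 ∧ ∀ t, 0 < t → t < t₀ → ∀ x,
      Integrable (p t x) ∧ 1 / 2 ≤ ∫ y, p t x y := by
  obtain ⟨t₀, ht₀, h⟩ := hp.approx (fun _ => 1) ⟨1, fun _ => by simp⟩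
    uniformContinuous_const (1 / 2) (by norm_num)
  refine ⟨min t₀ 1, lt_min ht₀ one_pos, min_le_right _ _, fun t ht htt x => ?_⟩
  have h1 := (abs_le.1 (h t ht (htt.trans_le (min_le_left _ _)) x)).1
  simp only [mul_one] at h1
  have h2 : 1 / 2 ≤ ∫ y, p t x y := by linarith
  refine ⟨?_, h2⟩
  by_contra hn
  rw [integral_undef hn] at h2
  norm_num at h2

lemma exists_integral_abs_kernel_le (H : HKAssumptions d φ J a₁ α₁ C₀ a b β κ κ₀ κ₁ κ₂ δ)
    (HΦ : PhiInvSpec φ Φinv) (hp : GoodHeatKernel d φ J b β Φinv κ p) {t : ℝ} (ht : 0 < t)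
    (ht1 : t ≤ 1) (hint : ∀ x, Integrable (p t x) ∧ 1 / 2 ≤ ∫ y, p t x y) :
    ∃ C, ∀ x, ∫ y, |p t x y| ≤ C := by
  obtain ⟨K, hK, hfar⟩ := exists_abs_kernel_le H hp
  obtain ⟨c, hc, hup⟩ := hp.upper 1 le_rfl
  have hΦ := HΦ.pos t ht
  set S := c * t * (1 / (t * Φinv t ^ d))
  have hS : 0 ≤ S := by positivity
  set N := 3 ^ (d + 2) * (S + K)
  have hN : 0 ≤ N := by positivity
  have hle : ∀ x y, p t x y ≤ N * decayProfile (x - y) := fun x y => by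
    refine le_decayProfile hS hK.le (fun _ => ?_) (fun h => ?_)
    · exact (hup t ht ht1 x y).trans
        (mul_le_mul_of_nonneg_left (Gfun_le_near t _) (by positivity))
    · have hxy : x ≠ y := by rintro rfl; simp at h; linarith
      refine (le_abs_self _).trans ((hfar t ht ht1 x y hxy).trans ?_)
      gcongr
      linarith
  have hdec : ∀ x : EuclideanSpace ℝ (Fin d), Integrable fun y => N * decayProfile (x - y) :=
    fun x => (integrable_decayProfile.comp_sub_left x).const_mul N
  refine ⟨2 * (N * ∫ y : EuclideanSpace ℝ (Fin d), decayProfile y), fun x => ?_⟩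
  calc ∫ y, |p t x y| ≤ ∫ y, (2 * (N * decayProfile (x - y)) - p t x y) := by
        refine integral_mono (hint x).1.abs (((hdec x).const_mul 2).sub (hint x).1) fun y => ?_
        have h0 : 0 ≤ N * decayProfile (x - y) := by unfold decayProfile; positivity
        exact abs_le'.2 ⟨by linarith [hle x y], by linarith⟩
    _ = 2 * (N * ∫ y : EuclideanSpace ℝ (Fin d), decayProfile y) - ∫ y, p t x y := by
        rw [integral_sub ((hdec x).const_mul 2) (hint x).1, integral_const_mul,
          integral_const_mul, integral_sub_left_eq_self decayProfile]
    _ ≤ _ := by linarith [(hint x).2]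

end Kernel

section Semigroup

variable {d : ℕ} {φ J : ℝ → ℝ} {a₁ α₁ C₀ a b β : ℝ}
  {κ : EuclideanSpace ℝ (Fin d) → EuclideanSpace ℝ (Fin d) → ℝ} {κ₀ κ₁ κ₂ δ : ℝ}
  {Φinv : ℝ → ℝ} {p : ℝ → EuclideanSpace ℝ (Fin d) → EuclideanSpace ℝ (Fin d) → ℝ}

lemma exists_Gtil_le_decayProfile (H : HKAssumptions d φ J a₁ α₁ C₀ a b β κ κ₀ κ₁ κ₂ δ)
    (HΦ : PhiInvSpec φ Φinv) {t₁ : ℝ} (ht₁ : 0 < t₁) :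
    ∃ B, ∀ s, t₁ ≤ s → ∀ x : EuclideanSpace ℝ (Fin d), x ≠ 0 →
      Gtil d φ Φinv s x ≤ B * decayProfile x := by
  obtain ⟨ρ, hρ, hlow⟩ := exists_lower_bound_Phi_inv H HΦ ht₁
  have hC := const_pos H
  refine ⟨_, fun s hs x hx => le_decayProfile (S := 1 / (t₁ * ρ ^ d)) (K := 2 * C₀)
    (by positivity) (by positivity) (fun _ => ?_) (fun h => ?_)⟩
  · refine (Gtil_le_near s x).trans ?_
    have := hlow s hs
    have hs0 : 0 ≤ s := ht₁.le.trans hs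
    gcongr
  · refine (Gtil_le_far H s hx).trans ?_
    gcongr
    linarith

lemma integrable_kernel_mul {t : ℝ} {x : EuclideanSpace ℝ (Fin d)} (hint : Integrable (p t x))
    {f : EuclideanSpace ℝ (Fin d) → ℝ} (hf : Continuous f) {M : ℝ} (hM : ∀ x, |f x| ≤ M) :
    Integrable fun y => p t x y * f y :=
  hint.mul_bdd hf.aestronglyMeasurable (ae_of_all _ hM)

lemma integrable_jump_difference_kernel
    (H : HKAssumptions d φ J a₁ α₁ C₀ a b β κ κ₀ κ₁ κ₂ δ)
    (hp : GoodHeatKernel d φ J b β Φinv κ p) {t : ℝ} (ht : 0 < t)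
    (hint : ∀ x, Integrable (p t x)) {C : ℝ} (hC : ∀ x, ∫ y, |p t x y| ≤ C)
    {f : EuclideanSpace ℝ (Fin d) → ℝ} (hf : Continuous f) {M : ℝ} (hM : ∀ x, |f x| ≤ M)
    (x : EuclideanSpace ℝ (Fin d)) {ε : ℝ} (hε : 0 < ε) :
    Integrable (fun q : EuclideanSpace ℝ (Fin d) × EuclideanSpace ℝ (Fin d) =>
      ((p t (x + q.1) q.2 - p t x q.2) * f q.2) * (κ x q.1 * J ‖q.1‖))
      ((volume.restrict {z : EuclideanSpace ℝ (Fin d) | ε < ‖z‖}).prod volume) := by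
  have hM0 : 0 ≤ M := (abs_nonneg _).trans (hM 0)
  have hC0 : 0 ≤ C := (integral_nonneg fun _ => abs_nonneg _).trans (hC 0)
  have hcont : Continuous fun q : EuclideanSpace ℝ (Fin d) × EuclideanSpace ℝ (Fin d) =>
      (p t (x + q.1) q.2 - p t x q.2) * f q.2 := by
    have hk := continuous_kernel hp ht
    have h1 : Continuous fun q : EuclideanSpace ℝ (Fin d) × EuclideanSpace ℝ (Fin d) =>
      p t (x + q.1) q.2 := hk.comp (by fun_prop :
        Continuous fun q : EuclideanSpace ℝ (Fin d) × EuclideanSpace ℝ (Fin d) =>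
          (x + q.1, q.2))
    have h2 := (continuous_kernel_right hp ht x).comp
      (continuous_snd (X := EuclideanSpace ℝ (Fin d)))
    exact (h1.sub h2).mul (hf.comp continuous_snd)
  have hmeas : Measurable fun q : EuclideanSpace ℝ (Fin d) × EuclideanSpace ℝ (Fin d) =>
      ((p t (x + q.1) q.2 - p t x q.2) * f q.2) * (κ x q.1 * J ‖q.1‖) :=
    hcont.measurable.mul ((measurable_jump_kernel H x).comp
    (measurable_fst (β := EuclideanSpace ℝ (Fin d))))
  have hy : ∀ z, Integrable fun y => (p t (x + z) y - p t x y) * f y := fun z =>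
    ((hint (x + z)).sub (hint x)).mul_bdd hf.aestronglyMeasurable (ae_of_all _ hM)
  refine (integrable_prod_iff hmeas.aestronglyMeasurable).2
    ⟨ae_of_all _ fun z => (hy z).mul_const (κ x z * J ‖z‖), ?_⟩
  refine Integrable.mono'
    (g := fun z => 2 * C * M / ε ^ 2 * κ₁ * (‖z‖ ^ 2 * J ‖z‖))
    ((integrable_sq_mul_jump H).const_mul _).integrableOn
    hmeas.aestronglyMeasurable.norm.integral_prod_right' ?_
  refine (ae_restrict_iff' (measurableSet_lt_norm ε)).2 (ae_of_all _ fun z hz => ?_)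
  have hm : |∫ y, ‖(p t (x + z) y - p t x y) * f y‖| ≤ 2 * C * M / ε ^ 2 * ‖z‖ ^ 2 := by
    rw [abs_of_nonneg (integral_nonneg fun _ => norm_nonneg _)]
    calc ∫ y, ‖(p t (x + z) y - p t x y) * f y‖
        ≤ ∫ y, (|p t (x + z) y| + |p t x y|) * M := by
          refine integral_mono (hy z).norm
            (((hint (x + z)).abs.add (hint x).abs).mul_const M) fun y => ?_
          rw [norm_mul]
          exact mul_le_mul (abs_sub _ _) (hM y) (abs_nonneg _) (by positivity)
      _ = (∫ y, |p t (x + z) y|) * M + (∫ y, |p t x y|) * M := by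
          rw [integral_mul_const, integral_add (hint (x + z)).abs (hint x).abs, add_mul]
      _ ≤ C * M + C * M := by gcongr <;> exact hC _
      _ = 2 * C * M / ε ^ 2 * ε ^ 2 := by field_simp; ring
      _ ≤ _ := by gcongr; exact le_of_lt hz
  have hn := norm_mul_jump_kernel_le H (x := x) hm
  rw [norm_mul, Real.norm_of_nonneg (integral_nonneg fun _ => norm_nonneg _)] at hn
  simp only [norm_mul _ (κ x _ * J _)]
  rw [integral_mul_const, norm_mul, norm_norm,
    Real.norm_of_nonneg (integral_nonneg fun _ => norm_nonneg _)]
  exact hn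

/-- The semigroup solves the evolution equation pointwise. -/
lemma semigroup_evolution (H : HKAssumptions d φ J a₁ α₁ C₀ a b β κ κ₀ κ₁ κ₂ δ)
    (HΦ : PhiInvSpec φ Φinv) (hp : GoodHeatKernel d φ J b β Φinv κ p) {t₀ : ℝ} (ht₀ : t₀ ≤ 1)
    (hint : ∀ t, 0 < t → t < t₀ → ∀ x, Integrable (p t x) ∧ 1 / 2 ≤ ∫ y, p t x y)
    {f : EuclideanSpace ℝ (Fin d) → ℝ} (hf : Continuous f) {M : ℝ} (hM : ∀ x, |f x| ≤ M)
    {t : ℝ} (ht : 0 < t) (htt : t < t₀) (x : EuclideanSpace ℝ (Fin d)) :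
    ∃ D, Tendsto (fun ε => Leps d κ J ε (fun x' => ∫ y, p t x' y * f y) x)
        (nhdsWithin 0 (Ioi 0)) (nhds D) ∧
      HasDerivAt (fun s => ∫ y, p s x y * f y) D t := by
  have hd := H.hd
  have : Nonempty (Fin d) := ⟨⟨0, hd⟩⟩
  obtain ⟨c, hc, hder⟩ := kernel_deriv_bounds hp
  obtain ⟨B, hB⟩ := exists_Gtil_le_decayProfile H HΦ (half_pos ht)
  obtain ⟨C, hC⟩ := exists_integral_abs_kernel_le H HΦ hp ht (htt.le.trans ht₀) (hint t ht htt)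
  have hne : ∀ᵐ y : EuclideanSpace ℝ (Fin d), x ≠ y := by
    have : ∀ᵐ y : EuclideanSpace ℝ (Fin d), y ∉ ({x} : Set _) :=
      measure_eq_zero_iff_ae_notMem.1 (measure_singleton x)
    filter_upwards [this] with y hy
    exact fun h => hy h.symm
  have hbound : Integrable fun y => c * (B * decayProfile (x - y)) * M :=
    (((integrable_decayProfile.comp_sub_left x).const_mul B).const_mul c).mul_const M
  have hGB : ∀ m : ℝ, ∀ s, t / 2 ≤ s → ∀ y, x ≠ y → |m| ≤ c * Gtil d φ Φinv s (x - y) →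
      ‖m * f y‖ ≤ c * (B * decayProfile (x - y)) * M := by
    intro m s hs y hxy hm
    have h1 : |m| ≤ c * (B * decayProfile (x - y)) :=
      hm.trans (mul_le_mul_of_nonneg_left (hB s hs _ (sub_ne_zero.2 hxy)) hc.le)
    rw [norm_mul]
    exact mul_le_mul h1 (hM y) (abs_nonneg _) ((abs_nonneg _).trans h1)
  have hprod := fun ε (hε : 0 < ε) => integrable_jump_difference_kernel H hp ht
    (fun x => (hint t ht htt x).1) hC hf hM x hε
  have hinner : ∀ ε y, ∫ z in {z : EuclideanSpace ℝ (Fin d) | ε < ‖z‖},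
      ((p t (x + z) y - p t x y) * f y) * (κ x z * J ‖z‖)
      = Leps d κ J ε (fun x' => p t x' y) x * f y := fun ε y => by
    rw [Leps, ← integral_mul_const]
    congr 1
    ext z
    ring
  have hswap : ∀ ε, 0 < ε → ∫ y, Leps d κ J ε (fun x' => p t x' y) x * f y
      = Leps d κ J ε (fun x' => ∫ y, p t x' y * f y) x := fun ε hε => by
    have h := integral_integral_swap (f := fun z y =>
      ((p t (x + z) y - p t x y) * f y) * (κ x z * J ‖z‖)) (hprod ε hε)
    simp only [hinner] at h
    rw [← h, Leps]
    congr 1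
    ext z
    rw [integral_mul_const, ← integral_sub
      (integrable_kernel_mul (hint t ht htt (x + z)).1 hf hM)
      (integrable_kernel_mul (hint t ht htt x).1 hf hM)]
    simp only [sub_mul]
  have hmeas : ∀ ε, 0 < ε →
      AEStronglyMeasurable fun y => Leps d κ J ε (fun x' => p t x' y) x * f y := fun ε hε => by
    have h := (hprod ε hε).integral_prod_right.aestronglyMeasurable
    simpa only [hinner] using h
  have hlim : ∀ᵐ y, Tendsto (fun ε => Leps d κ J ε (fun x' => p t x' y) x * f y)
      (nhdsWithin 0 (Ioi 0)) (nhds (deriv (fun s => p s x y) t * f y)) := by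
    filter_upwards [hne] with y hy
    exact (hder t ht (htt.le.trans ht₀) x y hy).2.1.mul_const _
  refine ⟨∫ y, deriv (fun s => p s x y) t * f y, ?_, ?_⟩
  · have htend := tendsto_integral_filter_of_dominated_convergence
      (F := fun ε y => Leps d κ J ε (fun x' => p t x' y) x * f y)
      (fun y => c * (B * decayProfile (x - y)) * M)
      (by filter_upwards [self_mem_nhdsWithin] with ε hε using hmeas ε hε)
      (by
        filter_upwards [Ioo_mem_nhdsGT (one_pos (α := ℝ))] with ε hε
        filter_upwards [hne] with y hy
        exact hGB _ t (half_le_self ht.le) y hy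
          ((hder t ht (htt.le.trans ht₀) x y hy).2.2.1 ε hε.1 hε.2.le)) hbound hlim
    refine htend.congr' ?_
    filter_upwards [self_mem_nhdsWithin] with ε hε using hswap ε hε
  · refine (hasDerivAt_integral_of_dominated_loc_of_deriv_le
      (F := fun s y => p s x y * f y) (F' := fun s y => deriv (fun s => p s x y) s * f y)
      (bound := fun y => c * (B * decayProfile (x - y)) * M)
      (Ioo_mem_nhds (half_lt_self ht) htt) ?_ (integrable_kernel_mul (hint t ht htt x).1 hf hM)
      ?_ ?_ hbound ?_).2
    · filter_upwards [lt_mem_nhds ht] with s hs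
      exact ((continuous_kernel_right hp hs x).mul hf).aestronglyMeasurable
    · have hseq := tendsto_nhdsWithin_iff.2 ⟨tendsto_one_div_add_atTop_nhds_zero_nat (𝕜 := ℝ),
        Eventually.of_forall fun n => (Nat.one_div_pos_of_nat : 0 < 1 / ((n : ℝ) + 1))⟩
      refine aestronglyMeasurable_of_tendsto_ae atTop
        (f := fun (n : ℕ) y => Leps d κ J (1 / ((n : ℝ) + 1)) (fun x' => p t x' y) x * f y)
        (fun n => hmeas _ Nat.one_div_pos_of_nat) ?_
      filter_upwards [hlim] with y hy using hy.comp hseq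
    · filter_upwards [hne] with y hy s hs
      exact hGB _ s hs.1.le y hy
        (hder s ((half_pos ht).trans hs.1) (hs.2.le.trans ht₀) x y hy).2.2.2
    · filter_upwards [hne] with y hy s hs
      exact (hder s ((half_pos ht).trans hs.1) (hs.2.le.trans ht₀) x y hy).1.mul_const _

lemma continuousOn_semigroup (H : HKAssumptions d φ J a₁ α₁ C₀ a b β κ κ₀ κ₁ κ₂ δ)
    (hp : GoodHeatKernel d φ J b β Φinv κ p)
    {f : EuclideanSpace ℝ (Fin d) → ℝ} (hf : Continuous f) {M : ℝ} (hM : ∀ x, |f x| ≤ M) :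
    ContinuousOn (fun q : ℝ × EuclideanSpace ℝ (Fin d) => ∫ y, p q.1 q.2 y * f y)
      (Ioo 0 1 ×ˢ univ) := by
  obtain ⟨K, hK, hfar⟩ := exists_abs_kernel_le H hp
  have hM0 : 0 ≤ M := (abs_nonneg _).trans (hM 0)
  rintro ⟨t, x⟩ ⟨ht, -⟩
  refine ContinuousAt.continuousWithinAt ?_
  have hcompact : IsCompact (Icc (t / 2) 1 ×ˢ (Metric.closedBall x 1 ×ˢ Metric.closedBall x 2)) :=
    isCompact_Icc.prod ((isCompact_closedBall x 1).prod (isCompact_closedBall x 2))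
  obtain ⟨S, hS⟩ := hcompact.exists_bound_of_continuousOn (hp.cont.mono fun q hq =>
    ⟨(half_pos ht.1).trans_le hq.1.1, mem_univ _⟩)
  have hS0 : 0 ≤ S := (norm_nonneg _).trans (hS (1, x, x)
    ⟨right_mem_Icc.2 (by linarith [ht.1, ht.2]), Metric.mem_closedBall_self zero_le_one,
      Metric.mem_closedBall_self zero_le_two⟩)
  have hnhds : Ioo (t / 2) 1 ×ˢ Metric.ball x 1 ∈ nhds (t, x) :=
    prod_mem_nhds (Ioo_mem_nhds (half_lt_self ht.1) ht.2) (Metric.ball_mem_nhds x one_pos)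
  refine continuousAt_of_dominated
    (bound := fun y => 3 ^ (d + 2) * (S + K) * decayProfile (x - y) * M) ?_ ?_
    (((integrable_decayProfile.comp_sub_left x).const_mul _).mul_const M) ?_
  · filter_upwards [hnhds] with q hq
    exact ((continuous_kernel_right hp ((half_pos ht.1).trans hq.1.1) q.2).mul
      hf).aestronglyMeasurable
  · filter_upwards [hnhds] with q hq
    refine ae_of_all _ fun y => ?_
    have hq2 : ‖x - q.2‖ < 1 := by rw [← dist_eq_norm, dist_comm]; exact hq.2
    have h1 : |p q.1 q.2 y| ≤ 3 ^ (d + 2) * (S + K) * decayProfile (x - y) := by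
      refine le_decayProfile hS0 hK.le (fun h => ?_) (fun h => ?_)
      · refine hS (q.1, q.2, y) ⟨Ioo_subset_Icc_self hq.1, Metric.ball_subset_closedBall hq.2, ?_⟩
        rw [Metric.mem_closedBall, dist_comm, dist_eq_norm]
        exact h
      · have htri : ‖x - y‖ ≤ ‖x - q.2‖ + ‖q.2 - y‖ := norm_sub_le_norm_sub_add_norm_sub x q.2 y
        have hqy : q.2 ≠ y := fun hqy => by rw [hqy] at hq2; linarith
        refine (hfar q.1 ((half_pos ht.1).trans hq.1.1) hq.1.2.le q.2 y hqy).trans ?_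
        gcongr
        linarith
    rw [norm_mul]
    exact mul_le_mul h1 (hM y) (abs_nonneg _) ((abs_nonneg _).trans h1)
  · refine ae_of_all _ fun y => ContinuousAt.mul ?_ continuousAt_const
    have hopen : IsOpen (Ioi (0 : ℝ) ×ˢ
        (univ : Set (EuclideanSpace ℝ (Fin d) × EuclideanSpace ℝ (Fin d)))) :=
      isOpen_Ioi.prod isOpen_univ
    have hpair : ContinuousAt (fun q : ℝ × EuclideanSpace ℝ (Fin d) => (q.1, q.2, y)) (t, x) := by
      fun_prop
    exact (hp.cont.continuousAt
      (hopen.mem_nhds (x := (t, x, y)) ⟨ht.1, mem_univ _⟩)).comp_of_eq hpair rfl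

end Semigroup

section MaximumPrinciple

/-- A function that is initially nonpositive, nonpositive far away, and strictly decreasing in time
at every spatial maximum stays nonpositive. -/
lemma nonpos_of_deriv_neg_at_spatial_max {V : Type*} [NormedAddCommGroup V] [ProperSpace V]
    {W : ℝ → V → ℝ} {T τ R : ℝ} (hτ : 0 < τ)
    (hcont : ContinuousOn (fun q : ℝ × V => W q.1 q.2) (Ioo 0 T ×ˢ univ))
    (hinit : ∀ t, 0 < t → t < τ → ∀ x, W t x ≤ 0)
    (hfar : ∀ t ∈ Ioo 0 T, ∀ x, R < ‖x‖ → W t x ≤ 0)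
    (hder : ∀ t ∈ Ioo 0 T, ∀ x, (∀ x', W t x' ≤ W t x) →
      ∃ D < 0, HasDerivAt (fun s => W s x) D t) :
    ∀ t ∈ Ioo 0 T, ∀ x, W t x ≤ 0 := by
  intro t₁ ht₁ x₁
  by_contra! hpos
  set τ' := min τ t₁ / 2
  have hmin : 0 < min τ t₁ := lt_min hτ ht₁.1
  have hτ'0 : 0 < τ' := half_pos hmin
  have hτ'τ : τ' < τ := (half_lt_self hmin).trans_le (min_le_left _ _)
  have hτ't : τ' < t₁ := (half_lt_self hmin).trans_le (min_le_right _ _)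
  have hsub : Icc τ' t₁ ⊆ Ioo 0 T := fun s hs => ⟨hτ'0.trans_le hs.1, hs.2.trans_lt ht₁.2⟩
  have hball : ∀ t ∈ Ioo 0 T, ∀ x, 0 < W t x → x ∈ Metric.closedBall (0 : V) R := by
    intro t ht x hx
    rw [mem_closedBall_zero_iff]
    by_contra! h
    exact absurd (hfar t ht x h) hx.not_ge
  obtain ⟨⟨s, x⟩, ⟨hs, -⟩, hmax⟩ :=
    (isCompact_Icc.prod (isCompact_closedBall (0 : V) R)).exists_isMaxOn
    ⟨(t₁, x₁), ⟨⟨hτ't.le, le_rfl⟩, hball t₁ ht₁ x₁ hpos⟩⟩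
    (hcont.mono (prod_mono hsub (subset_univ _)))
  have hWpos : 0 < W s x := hpos.trans_le
    (hmax (show (t₁, x₁) ∈ _ from ⟨⟨hτ't.le, le_rfl⟩, hball t₁ ht₁ x₁ hpos⟩))
  have hle : ∀ r ∈ Icc τ' t₁, ∀ y, W r y ≤ W s x := by
    intro r hr y
    by_cases hy : 0 < W r y
    · exact hmax (show (r, y) ∈ _ from ⟨hr, hball r (hsub hr) y hy⟩)
    · linarith
  obtain ⟨D, hD, hDer⟩ := hder s (hsub hs) x (hle s hs)
  have hτs : τ ≤ s := by
    by_contra! h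
    exact absurd (hinit s (hsub hs).1 h x) hWpos.not_ge
  have hslope := (hasDerivAt_iff_tendsto_slope.1 hDer).mono_left
    (nhdsWithin_mono s (show Iio s ⊆ {s}ᶜ from fun r hr => (mem_Iio.1 hr).ne))
  obtain ⟨r, hr, hrs⟩ := ((hslope.eventually (gt_mem_nhds hD)).and
    (Ioo_mem_nhdsLT (hτ'τ.trans_le hτs))).exists
  rw [slope_def_field, div_neg_iff] at hr
  have hrle := hle r ⟨hrs.1.le, hrs.2.le.trans hs.2⟩ x
  have hrs2 := hrs.2
  rcases hr with hr | hr <;> linarith [hr.1, hr.2]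

end MaximumPrinciple

section Comparison

variable {d : ℕ} {φ J : ℝ → ℝ} {a₁ α₁ C₀ a b β : ℝ}
  {κ : EuclideanSpace ℝ (Fin d) → EuclideanSpace ℝ (Fin d) → ℝ} {κ₀ κ₁ κ₂ δ : ℝ}
  {Φinv : ℝ → ℝ} {p : ℝ → EuclideanSpace ℝ (Fin d) → EuclideanSpace ℝ (Fin d) → ℝ}

lemma Leps_le_of_second_difference_le (H : HKAssumptions d φ J a₁ α₁ C₀ a b β κ κ₀ κ₁ κ₂ δ)
    {k : EuclideanSpace ℝ (Fin d) → ℝ} (hk : Continuous k) {ε A A' : ℝ} (hA' : 0 ≤ A')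
    {x : EuclideanSpace ℝ (Fin d)} (h : ∀ z, ε < ‖z‖ → |k (x + z) - k x| ≤ A * ‖z‖ ^ 2)
    (hsd : ∀ z, k (x + z) + k (x - z) - 2 * k x ≤ A' * ‖z‖ ^ 2) :
    Leps d κ J ε k x ≤ A' * (κ₁ * ∫ z : EuclideanSpace ℝ (Fin d), ‖z‖ ^ 2 * J ‖z‖) := by
  have hI : 0 ≤ ∫ z : EuclideanSpace ℝ (Fin d), ‖z‖ ^ 2 * J ‖z‖ :=
    integral_nonneg (sq_mul_jump_nonneg H)
  have hκ := H.κ₁_pos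
  rw [Leps_eq_half_second_difference H hk h]
  have hsd2 : ∀ z, ε < ‖z‖ → |k (x + z) + k (x - z) - 2 * k x| ≤ 2 * A * ‖z‖ ^ 2 := by
    intro z hz
    have h1 := abs_le.1 (h z hz)
    have h2 := abs_le.1 (h (-z) (by simpa using hz))
    rw [← sub_eq_add_neg, norm_neg] at h2
    exact abs_le.2 ⟨by linarith [h1.1, h2.1], by linarith [h1.2, h2.2]⟩
  have hmono : ∫ z in {z : EuclideanSpace ℝ (Fin d) | ε < ‖z‖},
      (k (x + z) + k (x - z) - 2 * k x) * (κ x z * J ‖z‖)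
      ≤ ∫ z in {z : EuclideanSpace ℝ (Fin d) | ε < ‖z‖}, A' * κ₁ * (‖z‖ ^ 2 * J ‖z‖) := by
    refine integral_mono (integrableOn_mul_jump_kernel H (by fun_prop)
      (measurableSet_lt_norm ε) hsd2 x) ((integrable_sq_mul_jump H).const_mul _).integrableOn
      fun z => ?_
    rcases eq_or_ne z 0 with rfl | hz
    · simp [two_mul]
    · have hJ := H.J_pos ‖z‖ (norm_pos_iff.2 hz)
      have hκ0 : 0 ≤ κ x z := H.κ₀_pos.le.trans (H.κ_low x z)
      calc (k (x + z) + k (x - z) - 2 * k x) * (κ x z * J ‖z‖)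
          ≤ (A' * ‖z‖ ^ 2) * (κ x z * J ‖z‖) := by gcongr; exact hsd z
        _ ≤ (A' * ‖z‖ ^ 2) * (κ₁ * J ‖z‖) := by gcongr; exact H.κ_up x z
        _ = A' * κ₁ * (‖z‖ ^ 2 * J ‖z‖) := by ring
  have hset := setIntegral_le_integral (s := {z : EuclideanSpace ℝ (Fin d) | ε < ‖z‖})
    ((integrable_sq_mul_jump H).const_mul (A' * κ₁))
    (ae_of_all _ fun z => mul_nonneg (by positivity) (sq_mul_jump_nonneg H z))
  have hconst := integral_const_mul (μ := volume) (A' * κ₁)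
    fun z : EuclideanSpace ℝ (Fin d) => ‖z‖ ^ 2 * J ‖z‖
  have hnn : 0 ≤ A' * κ₁ * ∫ z : EuclideanSpace ℝ (Fin d), ‖z‖ ^ 2 * J ‖z‖ := by positivity
  linarith

lemma Leps_le_of_increment_le (H : HKAssumptions d φ J a₁ α₁ C₀ a b β κ κ₀ κ₁ κ₂ δ)
    {u f k : EuclideanSpace ℝ (Fin d) → ℝ} (hu : Continuous u) (hf : Continuous f)
    (hk : Continuous k) {Mu Mf ε A A' : ℝ} (hε : 0 < ε) (hMu : ∀ x, |u x| ≤ Mu)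
    (hMf : ∀ x, |f x| ≤ Mf) (hA' : 0 ≤ A') {x : EuclideanSpace ℝ (Fin d)}
    (h : ∀ z, ε < ‖z‖ → |k (x + z) - k x| ≤ A * ‖z‖ ^ 2)
    (hsd : ∀ z, k (x + z) + k (x - z) - 2 * k x ≤ A' * ‖z‖ ^ 2)
    (hle : ∀ z, u (x + z) - u x ≤ (f (x + z) - f x) + (k (x + z) - k x)) :
    Leps d κ J ε u x ≤ Leps d κ J ε f x
      + A' * (κ₁ * ∫ z : EuclideanSpace ℝ (Fin d), ‖z‖ ^ 2 * J ‖z‖) := by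
  refine le_trans ?_ (add_le_add_right (Leps_le_of_second_difference_le H hk hA' h hsd) _)
  have hiu := integrableOn_mul_jump_kernel H (k := fun z => u (x + z) - u x) (by fun_prop)
    (measurableSet_lt_norm ε) (abs_sub_le_of_bounded hMu hε x) x
  have hif := integrableOn_mul_jump_kernel H (k := fun z => f (x + z) - f x) (by fun_prop)
    (measurableSet_lt_norm ε) (abs_sub_le_of_bounded hMf hε x) x
  have hik := integrableOn_mul_jump_kernel H (k := fun z => k (x + z) - k x) (by fun_prop)
    (measurableSet_lt_norm ε) h x
  rw [Leps, Leps, Leps, ← integral_add hif hik]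
  refine setIntegral_mono_on hiu (hif.add hik) (measurableSet_lt_norm ε) fun z hz => ?_
  have hJ := H.J_pos ‖z‖ (hε.trans hz)
  have hκ0 : 0 ≤ κ x z := H.κ₀_pos.le.trans (H.κ_low x z)
  rw [← add_mul]
  exact mul_le_mul_of_nonneg_right (hle z) (by positivity)

/-- One-sided comparison of the semigroup with its first order expansion. -/
lemma semigroup_sub_le (H : HKAssumptions d φ J a₁ α₁ C₀ a b β κ κ₀ κ₁ κ₂ δ)
    (HΦ : PhiInvSpec φ Φinv) (hp : GoodHeatKernel d φ J b β Φinv κ p)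
    {f : EuclideanSpace ℝ (Fin d) → ℝ} (hf : UniformContinuous f) {M A : ℝ}
    (hM : ∀ x, |f x| ≤ M)
    (hA : ∀ x z, |f (x + z) + f (x - z) - 2 * f x| ≤ A * ‖z‖ ^ 2)
    (hF : UniformContinuous (symmGenerator κ J f)) {η : ℝ} (hη : 0 < η) :
    ∃ T, 0 < T ∧ ∀ t, 0 < t → t < T → ∀ x,
      (∫ y, p t x y * f y) - f x ≤ t * (symmGenerator κ J f x + 3 * η) := by
  obtain ⟨g, hg, ⟨B, hB⟩, ⟨A', hA'0, hA'⟩, hFg⟩ := exists_semiconcave_approx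
    (fun x => abs_symmGenerator_le H (hA x)) hF hη
  set K := κ₁ * ∫ z : EuclideanSpace ℝ (Fin d), ‖z‖ ^ 2 * J ‖z‖
  have hK0 : 0 ≤ K := mul_nonneg H.κ₁_pos.le (integral_nonneg (sq_mul_jump_nonneg H))
  have hB0 : 0 ≤ B := (abs_nonneg _).trans (hB 0)
  obtain ⟨t₀, ht₀, ht₀1, hint⟩ := exists_integrable_kernel hp
  obtain ⟨t₁, ht₁, happrox⟩ := hp.approx f ⟨M, hM⟩ hf 1 one_pos
  set u : ℝ → EuclideanSpace ℝ (Fin d) → ℝ := fun t x => ∫ y, p t x y * f y with hu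
  set T := min (min t₀ t₁) (η / (A' * K + 1))
  have hT0 : 0 < T := by positivity
  have hTt₀ : T ≤ t₀ := (min_le_left _ _).trans (min_le_left _ _)
  have hTt₁ : T ≤ t₁ := (min_le_left _ _).trans (min_le_right _ _)
  have hTη : ∀ t ∈ Ioo 0 T, t * A' * K < η := fun t ht => by
    have h1 := (lt_div_iff₀ (by positivity)).1 (ht.2.trans_le (min_le_right _ _))
    nlinarith [ht.1]
  have hucont : ContinuousOn (fun q : ℝ × EuclideanSpace ℝ (Fin d) => u q.1 q.2)
      (Ioo 0 T ×ˢ univ) := (continuousOn_semigroup H hp hf.continuous hM).mono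
    (prod_mono (Ioo_subset_Ioo_right (hTt₀.trans ht₀1)) (subset_univ _))
  have hux : ∀ t ∈ Ioo 0 T, Continuous (u t) := fun t ht =>
    continuousOn_univ.1 (hucont.comp (f := fun x => (t, x)) (by fun_prop)
      fun x _ => ⟨ht, mem_univ _⟩)
  have huM : ∀ t ∈ Ioo 0 T, ∀ x, |u t x| ≤ M + 1 := fun t ht x => by
    have h1 := abs_le.1 (happrox t ht.1 (ht.2.trans_le hTt₁) x)
    have h2 := abs_le.1 (hM x)
    exact abs_le.2 ⟨by linarith [h1.1, h2.1], by linarith [h1.2, h2.2]⟩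
  have hW : ∀ l, 0 < l → ∀ t ∈ Ioo 0 T, ∀ x,
      u t x - f x - t * g x - l * japaneseBracket x - (2 * η + l * K) * t - l ≤ 0 := by
    intro l hl
    obtain ⟨τ, hτ, hτf⟩ := hp.approx f ⟨M, hM⟩ hf l hl
    refine nonpos_of_deriv_neg_at_spatial_max (τ := min τ (l / (B + 1))) (R := (1 + B) / l)
      (by positivity) ?_ ?_ ?_ ?_
    · have h1 : Continuous fun q : ℝ × EuclideanSpace ℝ (Fin d) =>
          f q.2 + q.1 * g q.2 + l * japaneseBracket q.2 + (2 * η + l * K) * q.1 + l := by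
        have := hf.continuous
        have := continuous_japaneseBracket (V := EuclideanSpace ℝ (Fin d))
        fun_prop
      exact (hucont.sub h1.continuousOn).congr fun q _ => by
        simp only [Pi.sub_apply]
        ring
    · intro t ht htτ x
      have h1 := (abs_le.1 (hτf t ht (htτ.trans_le (min_le_left _ _)) x)).2
      have h2 := (lt_div_iff₀ (by positivity)).1 (htτ.trans_le (min_le_right _ _))
      have h3 : -(t * B) ≤ t * g x := by
        rw [← mul_neg]; exact mul_le_mul_of_nonneg_left (abs_le.1 (hB x)).1 ht.le
      have h4 : l * 1 ≤ l * japaneseBracket x :=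
        mul_le_mul_of_nonneg_left (one_le_japaneseBracket x) hl.le
      have h5 : 0 ≤ (2 * η + l * K) * t := by positivity
      simp only [hu]
      linarith
    · intro t ht x hx
      have h1 := (abs_le.1 (happrox t ht.1 (ht.2.trans_le hTt₁) x)).2
      have ht1 : t ≤ 1 := ht.2.le.trans (hTt₀.trans ht₀1)
      have h2 : -B ≤ t * g x := by
        have := mul_le_mul_of_nonneg_left (abs_le.1 (hB x)).1 ht.1.le
        nlinarith
      have h3 : 1 + B < l * ‖x‖ := by rw [mul_comm]; exact (div_lt_iff₀ hl).1 hx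
      have h4 : l * ‖x‖ ≤ l * japaneseBracket x :=
        mul_le_mul_of_nonneg_left (norm_le_japaneseBracket x) hl.le
      have h5 : 0 ≤ (2 * η + l * K) * t := mul_nonneg (by positivity) ht.1.le
      simp only [hu]
      linarith
    · intro t ht x hmax
      obtain ⟨D, hD, hDer⟩ := semigroup_evolution H HΦ hp ht₀1 hint hf.continuous hM ht.1
        (ht.2.trans_le hTt₀) x
      refine ⟨D - g x - (2 * η + l * K), ?_, ?_⟩
      · have hDle : D ≤ symmGenerator κ J f x + (t * A' + l) * K := by
          refine le_of_tendsto_of_tendsto hD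
            ((tendsto_Leps_symmGenerator H hf.continuous hM hA x).add_const _) ?_
          filter_upwards [self_mem_nhdsWithin] with ε hε
          have hε : 0 < ε := hε
          refine Leps_le_of_increment_le H (u := u t) (k := fun y => t * g y + l * japaneseBracket y)
            (A := t * (2 * B / ε ^ 2) + l / ε)
            (hux t ht) hf.continuous ?_ hε (huM t ht) hM ?_ ?_ ?_ ?_
          · have := continuous_japaneseBracket (V := EuclideanSpace ℝ (Fin d))
            fun_prop
          · have := ht.1
            positivity
          · intro z hz
            have h1 := abs_sub_le_of_bounded hB hε x z hz
            have h2 := abs_japaneseBracket_sub_le (x + z) x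
            rw [add_sub_cancel_left] at h2
            have h3 : ‖z‖ ≤ 1 / ε * ‖z‖ ^ 2 := by
              rw [one_div_mul_eq_div, le_div_iff₀ hε, sq]
              exact mul_le_mul_of_nonneg_left (le_of_lt hz) (norm_nonneg _)
            calc |t * g (x + z) + l * japaneseBracket (x + z)
                  - (t * g x + l * japaneseBracket x)|
                = |t * (g (x + z) - g x)
                    + l * (japaneseBracket (x + z) - japaneseBracket x)| := by congr 1; ring
              _ ≤ t * |g (x + z) - g x| + l * |japaneseBracket (x + z) - japaneseBracket x| := by
                  refine (abs_add_le _ _).trans_eq ?_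
                  rw [abs_mul, abs_mul, abs_of_pos ht.1, abs_of_pos hl]
              _ ≤ t * (2 * B / ε ^ 2 * ‖z‖ ^ 2) + l * (1 / ε * ‖z‖ ^ 2) := by
                  have := ht.1
                  gcongr
                  exact h2.trans h3
              _ = _ := by ring
          · intro z
            have h1 := mul_le_mul_of_nonneg_left (hA' x z) ht.1.le
            have h2 := mul_le_mul_of_nonneg_left (japaneseBracket_second_difference_le x z) hl.le
            linarith
          · intro z
            linarith [hmax (x + z)]
        have h1 := (abs_le.1 (hFg x)).2
        have h2 := hTη t ht
        linarith
      · have h1 := (((((hDer.sub_const (f x)).sub ((hasDerivAt_id t).mul_const (g x))).sub_const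
          (l * japaneseBracket x)).sub ((hasDerivAt_id t).const_mul (2 * η + l * K))).sub_const l)
        simpa using h1
  refine ⟨T, hT0, fun t ht htT x => ?_⟩
  have hle : u t x - f x ≤ t * (g x + 2 * η) := by
    refine le_of_forall_pos_le_add fun e he => ?_
    have hden : 0 < japaneseBracket x + K * t + 1 := by
      have := one_le_japaneseBracket x
      positivity
    have h1 := hW (e / (japaneseBracket x + K * t + 1)) (by positivity) t ⟨ht, htT⟩ x
    have h2 := div_mul_cancel₀ e hden.ne'
    linarith
  refine hle.trans (mul_le_mul_of_nonneg_left ?_ ht.le)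
  linarith [(abs_le.1 (hFg x)).1]

end Comparison

section Holder

/-- Second differences inherit the Hölder continuity of the second derivative. -/
lemma abs_second_difference_sub_le {V : Type*} [NormedAddCommGroup V] [InnerProductSpace ℝ V]
    {f : V → ℝ} (hf : ContDiff ℝ 2 f) {C ε : ℝ}
    (hC : ∀ x y, ‖fderiv ℝ (fderiv ℝ f) x - fderiv ℝ (fderiv ℝ f) y‖ ≤ C * ‖x - y‖ ^ ε)
    (x y z : V) :
    |(f (x + z) + f (x - z) - 2 * f x) - (f (y + z) + f (y - z) - 2 * f y)|
      ≤ 2 * C * ‖x - y‖ ^ ε * ‖z‖ ^ 2 := by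
  have hshift : ContDiff ℝ 2 fun w => f (w + (x - y)) := by fun_prop
  have hd1 : fderiv ℝ (fun w => f (w + (x - y)) - f w)
      = fun w => fderiv ℝ f (w + (x - y)) - fderiv ℝ f w := by
    ext1 w
    rw [fderiv_fun_sub (hshift.differentiable (by norm_num) w)
      (hf.differentiable (by norm_num) w), fderiv_comp_add_right]
  have hdf : Differentiable ℝ (fderiv ℝ f) :=
    (hf.fderiv_right (m := 1) (by norm_num)).differentiable (by norm_num)
  have hM : ∀ w, ‖fderiv ℝ (fderiv ℝ fun w => f (w + (x - y)) - f w) w‖ ≤ C * ‖x - y‖ ^ ε := by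
    intro w
    rw [hd1, fderiv_fun_sub (by fun_prop) (hdf w), fderiv_comp_add_right]
    simpa using hC (w + (x - y)) w
  have h := second_difference_le_of_norm_fderiv_fderiv_le (hshift.sub hf) hM y z
  calc _ = |(fun w => f (w + (x - y)) - f w) (y + z) + (fun w => f (w + (x - y)) - f w) (y - z)
        - 2 * (fun w => f (w + (x - y)) - f w) y| := by
        dsimp only
        rw [show y + z + (x - y) = x + z by abel, show y - z + (x - y) = x - z by abel,
          show y + (x - y) = x by abel]
        congr 1
        ring
    _ ≤ _ := h
    _ = _ := by ring

end Holder

/-- the semigroup of the good heat kernel has generator `L^κ` on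
bounded `C^{2,ε₀}` functions, uniformly in `x`. -/
theorem heat_kernel_generator
    (d : ℕ) (φ J : ℝ → ℝ) (a₁ α₁ C₀ a b β : ℝ)
    (κ : EuclideanSpace ℝ (Fin d) → EuclideanSpace ℝ (Fin d) → ℝ)
    (κ₀ κ₁ κ₂ δ : ℝ)
    (H : HKAssumptions d φ J a₁ α₁ C₀ a b β κ κ₀ κ₁ κ₂ δ)
    (Φinv : ℝ → ℝ) (HΦ : PhiInvSpec φ Φinv)
    (p : ℝ → EuclideanSpace ℝ (Fin d) → EuclideanSpace ℝ (Fin d) → ℝ)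
    (hp : GoodHeatKernel d φ J b β Φinv κ p)
    (ε₀ : ℝ) (hε₀ : 0 < ε₀)
    (f : EuclideanSpace ℝ (Fin d) → ℝ)
    (hf_bdd : ∃ M, ∀ x, |f x| ≤ M)
    (hf_smooth : ContDiff ℝ 2 f)
    (hf_d1 : ∃ M₁, ∀ x, ‖fderiv ℝ f x‖ ≤ M₁)
    (hf_d2 : ∃ M₂, ∀ x, ‖fderiv ℝ (fderiv ℝ f) x‖ ≤ M₂)
    (hf_holder : ∃ Hc : ℝ, ∀ x y,
      ‖fderiv ℝ (fderiv ℝ f) x - fderiv ℝ (fderiv ℝ f) y‖ ≤ Hc * ‖x - y‖ ^ ε₀) :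
    ∃ Lf : EuclideanSpace ℝ (Fin d) → ℝ,
      (∀ x, Filter.Tendsto (fun ε => Leps d κ J ε f x)
        (nhdsWithin 0 (Set.Ioi 0)) (nhds (Lf x)))
      ∧ (∀ η : ℝ, 0 < η → ∃ t₀ : ℝ, 0 < t₀ ∧ ∀ t : ℝ, 0 < t → t < t₀ →
          ∀ x, |((∫ y, p t x y * f y) - f x) / t - Lf x| ≤ η) := by
  obtain ⟨M, hM⟩ := hf_bdd
  obtain ⟨M₁, hM₁⟩ := hf_d1
  obtain ⟨M₂, hM₂⟩ := hf_d2
  obtain ⟨Hc, hHc⟩ := hf_holder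
  have hA := second_difference_le_of_norm_fderiv_fderiv_le hf_smooth hM₂
  have hfu : UniformContinuous f := by
    refine LipschitzWith.uniformContinuous (K := M₁.toNNReal)
      (lipschitzWith_of_nnnorm_fderiv_le (𝕜 := ℝ) (hf_smooth.differentiable (by norm_num))
        fun x => ?_)
    rw [← NNReal.coe_le_coe, coe_nnnorm]
    exact (hM₁ x).trans (Real.le_coe_toNNReal M₁)
  have hF := uniformContinuous_symmGenerator H hf_smooth.continuous hε₀ hA
    (abs_second_difference_sub_le hf_smooth hHc)
  refine ⟨symmGenerator κ J f,
    tendsto_Leps_symmGenerator H hf_smooth.continuous hM hA, fun η hη => ?_⟩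
  have hη3 : 0 < η / 3 := by positivity
  obtain ⟨T, hT, hup⟩ := semigroup_sub_le H HΦ hp hfu hM hA hF hη3
  obtain ⟨T', hT', hlow⟩ := semigroup_sub_le H HΦ hp (f := fun y => -f y) hfu.neg
    (fun x => by rw [abs_neg]; exact hM x)
    (fun x z => by
      rw [show -f (x + z) + -f (x - z) - 2 * -f x = -(f (x + z) + f (x - z) - 2 * f x) by ring,
        abs_neg]
      exact hA x z)
    (by simpa only [funext (symmGenerator_neg (κ := κ) (J := J) f)] using hF.neg) hη3
  refine ⟨min T T', lt_min hT hT', fun t ht htT x => ?_⟩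
  have h1 := hup t ht (htT.trans_le (min_le_left _ _)) x
  have h2 := hlow t ht (htT.trans_le (min_le_right _ _)) x
  simp only [mul_neg, integral_neg, symmGenerator_neg] at h2
  rw [abs_le, neg_le_sub_iff_le_add, sub_le_iff_le_add, div_le_iff₀ ht, ← sub_le_iff_le_add,
    le_div_iff₀ ht]
  constructor <;> linarith
end

section
/- The function Φ is continuous and strictly increasing on (0,∞), satisfies lim_{r↓0} Φ(r) = 0, satisfies Φ(r) ≤ φ(r) for all 0 < r ≤ 1, and satisfies the two-sided weak scaling property a₁ (R/r)^{α₁} ≤ Φ(R)/Φ(r) ≤ (R/r)² for all 0 < r ≤ R, where a₁ > 0 and α₁ ∈ (0,2] are the constants in the lower weak scaling condition for φ. -/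
open MeasureTheory Filter Set

attribute [local instance] Classical.propDecidable

/-- `Phi` as a single quotient of `r ^ 2` by an interval integral truncated at `1`. -/
lemma Phi_eq_div_integral_min (φ : ℝ → ℝ) {r : ℝ} (hr : 0 < r) :
    Phi φ r = r ^ 2 / (2 * ∫ s in (0:ℝ)..min r 1, s / φ s) := by
  unfold Phi
  split_ifs with h
  · rw [min_eq_left h, intervalIntegral.integral_of_le hr.le, integral_Ioc_eq_integral_Ioo]
  · rw [min_eq_right (not_le.1 h).le, intervalIntegral.integral_of_le zero_le_one,
      integral_Ioc_eq_integral_Ioo]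
    ring

lemma Phi_of_one_le (φ : ℝ → ℝ) {r : ℝ} (hr : 1 ≤ r) : Phi φ r = Phi φ 1 * r ^ 2 := by
  rw [Phi_eq_div_integral_min φ (by linarith), Phi_eq_div_integral_min φ one_pos,
    min_eq_right hr, min_self]
  ring

/-- Dilating the variable in `∫ s / φ s` by the factor `R / r`. -/
lemma integral_div_eq_sq_mul_integral_dilate (φ : ℝ → ℝ) {r : ℝ} (hr : 0 < r) (R : ℝ) :
    ∫ s in (0:ℝ)..R, s / φ s = (R / r) ^ 2 * ∫ s in (0:ℝ)..r, s / φ (R / r * s) := by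
  have h := intervalIntegral.mul_integral_comp_mul_left (a := 0) (b := r)
    (f := fun s => s / φ s) (R / r)
  rw [mul_zero, div_mul_cancel₀ R hr.ne'] at h
  simp only [mul_div_assoc, intervalIntegral.integral_const_mul] at h
  rw [← h, sq, mul_assoc]

section

variable {φ : ℝ → ℝ}

lemma pos_of_strictMonoOn_unit (hφmono : StrictMonoOn φ (Icc 0 1)) (hφzero : φ 0 = 0)
    {s : ℝ} (hs : 0 < s) (hs' : s ≤ 1) : 0 < φ s :=
  hφzero ▸ hφmono ⟨le_rfl, zero_le_one⟩ ⟨hs.le, hs'⟩ hs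

lemma intervalIntegrable_div_unit (hI : IntegrableOn (fun s => s / φ s) (Ioo (0:ℝ) 1)) :
    IntervalIntegrable (fun s => s / φ s) volume 0 1 :=
  (intervalIntegrable_iff_integrableOn_Ioo_of_le zero_le_one).2 hI

lemma intervalIntegrable_div (hI : IntegrableOn (fun s => s / φ s) (Ioo (0:ℝ) 1))
    {r : ℝ} (hr : 0 < r) (hr' : r ≤ 1) :
    IntervalIntegrable (fun s => s / φ s) volume 0 r :=
  (intervalIntegrable_div_unit hI).mono_set
    (by rw [uIcc_of_le hr.le, uIcc_of_le zero_le_one]; exact Icc_subset_Icc_right hr')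

lemma intervalIntegrable_div_dilate (hI : IntegrableOn (fun s => s / φ s) (Ioo (0:ℝ) 1))
    {r R : ℝ} (hr : 0 < r) (hR : 0 < R) (hR' : R ≤ 1) :
    IntervalIntegrable (fun s => s / φ (R / r * s)) volume 0 r := by
  have hc : R / r ≠ 0 := (div_pos hR hr).ne'
  have h := ((intervalIntegrable_div hI hR hR').comp_mul_left (c := R / r)).const_mul (R / r)⁻¹
  have e : R / (R / r) = r := by field_simp
  rw [zero_div, e] at h
  refine h.congr fun s _ => ?_
  rw [mul_div_assoc, inv_mul_cancel_left₀ hc]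

lemma integral_div_pos (hφmono : StrictMonoOn φ (Icc 0 1)) (hφzero : φ 0 = 0)
    (hI : IntegrableOn (fun s => s / φ s) (Ioo (0:ℝ) 1)) {r : ℝ} (hr : 0 < r) (hr' : r ≤ 1) :
    0 < ∫ s in (0:ℝ)..r, s / φ s :=
  intervalIntegral.intervalIntegral_pos_of_pos_on (intervalIntegrable_div hI hr hr')
    (fun _ hs => div_pos hs.1
      (pos_of_strictMonoOn_unit hφmono hφzero hs.1 (hs.2.le.trans hr'))) hr

lemma Phi_pos (hφmono : StrictMonoOn φ (Icc 0 1)) (hφzero : φ 0 = 0)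
    (hI : IntegrableOn (fun s => s / φ s) (Ioo (0:ℝ) 1)) {r : ℝ} (hr : 0 < r) :
    0 < Phi φ r := by
  rw [Phi_eq_div_integral_min φ hr]
  have := integral_div_pos hφmono hφzero hI (lt_min hr one_pos) (min_le_right r 1)
  positivity

lemma continuousOn_Phi (hφmono : StrictMonoOn φ (Icc 0 1)) (hφzero : φ 0 = 0)
    (hI : IntegrableOn (fun s => s / φ s) (Ioo (0:ℝ) 1)) :
    ContinuousOn (Phi φ) (Ioi 0) := by
  have hJ : ContinuousOn (fun r => ∫ s in (0:ℝ)..r, s / φ s) (Icc 0 1) := by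
    have := intervalIntegral.continuousOn_primitive_interval
      ((intervalIntegrable_iff' (by simp)).1 (intervalIntegrable_div_unit hI))
    rwa [uIcc_of_le zero_le_one] at this
  have hJ' : ContinuousOn (fun r => ∫ s in (0:ℝ)..min r 1, s / φ s) (Ioi 0) :=
    hJ.comp (f := fun r : ℝ => min r 1) (by fun_prop)
      fun r hr => ⟨le_min (le_of_lt hr) zero_le_one, min_le_right _ _⟩
  refine ContinuousOn.congr (f := fun r => r ^ 2 / (2 * ∫ s in (0:ℝ)..min r 1, s / φ s)) ?_
    fun r hr => Phi_eq_div_integral_min φ hr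
  refine (continuousOn_id.pow 2).div (continuousOn_const.mul hJ') fun r hr => ?_
  have := integral_div_pos hφmono hφzero hI (lt_min hr one_pos) (min_le_right r 1)
  positivity

lemma Phi_lt_Phi_of_le_one (hφmono : StrictMonoOn φ (Icc 0 1)) (hφzero : φ 0 = 0)
    (hI : IntegrableOn (fun s => s / φ s) (Ioo (0:ℝ) 1))
    {r R : ℝ} (hr : 0 < r) (hrR : r < R) (hR : R ≤ 1) : Phi φ r < Phi φ R := by
  have hR0 := hr.trans hrR
  rw [Phi_eq_div_integral_min φ hr, Phi_eq_div_integral_min φ hR0, min_eq_left hR,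
    min_eq_left (hrR.le.trans hR)]
  have hposR := integral_div_pos hφmono hφzero hI hR0 hR
  have hposr := integral_div_pos hφmono hφzero hI hr (hrR.le.trans hR)
  have hir := intervalIntegrable_div hI hr (hrR.le.trans hR)
  have hiR := intervalIntegrable_div_dilate hI hr hR0 hR
  have hc : 1 < R / r := (one_lt_div hr).2 hrR
  have hlt : 0 < ∫ s in (0:ℝ)..r, (s / φ s - s / φ (R / r * s)) := by
    refine intervalIntegral.intervalIntegral_pos_of_pos_on (hir.sub hiR) (fun s hs => ?_) hr
    have hs1 : R / r * s ≤ 1 := by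
      calc R / r * s ≤ R / r * r := by gcongr; exact hs.2.le
        _ = R := div_mul_cancel₀ R hr.ne'
        _ ≤ 1 := hR
    have hs2 : s < R / r * s := lt_mul_of_one_lt_left hs.1 hc
    exact sub_pos.2 (div_lt_div_of_pos_left hs.1
      (pos_of_strictMonoOn_unit hφmono hφzero hs.1 (hs2.le.trans hs1))
      (hφmono ⟨hs.1.le, hs2.le.trans hs1⟩ ⟨(hs.1.trans hs2).le, hs1⟩ hs2))
  rw [intervalIntegral.integral_sub hir hiR, sub_pos] at hlt
  rw [integral_div_eq_sq_mul_integral_dilate φ hr R] at hposR ⊢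
  have hpos := pos_of_mul_pos_right hposR (sq_nonneg (R / r))
  have e : R ^ 2 / (2 * ((R / r) ^ 2 * ∫ s in (0:ℝ)..r, s / φ (R / r * s)))
      = r ^ 2 / (2 * ∫ s in (0:ℝ)..r, s / φ (R / r * s)) := by
    field_simp
  rw [e]
  gcongr

lemma strictMonoOn_Phi (hφmono : StrictMonoOn φ (Icc 0 1)) (hφzero : φ 0 = 0)
    (hI : IntegrableOn (fun s => s / φ s) (Ioo (0:ℝ) 1)) :
    StrictMonoOn (Phi φ) (Ioi 0) := by
  have hbelow : StrictMonoOn (Phi φ) (Ioc 0 1) := fun r hr R hR hrR =>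
    Phi_lt_Phi_of_le_one hφmono hφzero hI hr.1 hrR hR.2
  have habove : StrictMonoOn (Phi φ) (Ici 1) := fun r hr R hR hrR => by
    rw [mem_Ici] at hr hR
    rw [Phi_of_one_le φ hr, Phi_of_one_le φ hR]
    have := Phi_pos hφmono hφzero hI one_pos
    gcongr
  rw [← Ioc_union_Ici_eq_Ioi zero_lt_one]
  exact hbelow.union habove ⟨⟨zero_lt_one, le_rfl⟩, fun _ h => h.2⟩ ⟨mem_Ici.2 le_rfl, fun _ h => h⟩

lemma Phi_le_self (hφmono : StrictMonoOn φ (Icc 0 1)) (hφzero : φ 0 = 0)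
    (hI : IntegrableOn (fun s => s / φ s) (Ioo (0:ℝ) 1)) {r : ℝ} (hr : 0 < r) (hr' : r ≤ 1) :
    Phi φ r ≤ φ r := by
  have hφr := pos_of_strictMonoOn_unit hφmono hφzero hr hr'
  have h : ∫ s in (0:ℝ)..r, s / φ r ≤ ∫ s in (0:ℝ)..r, s / φ s := by
    refine intervalIntegral.integral_mono_on_of_le_Ioo hr.le
      (Continuous.intervalIntegrable (by fun_prop) _ _)
      (intervalIntegrable_div hI hr hr') fun s hs => ?_
    exact div_le_div_of_nonneg_left hs.1.le
      (pos_of_strictMonoOn_unit hφmono hφzero hs.1 (hs.2.le.trans hr'))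
      (hφmono.monotoneOn ⟨hs.1.le, hs.2.le.trans hr'⟩ ⟨hr.le, hr'⟩ hs.2.le)
  rw [intervalIntegral.integral_div, integral_id, div_le_iff₀ hφr] at h
  have hpos := integral_div_pos hφmono hφzero hI hr hr'
  rw [Phi_eq_div_integral_min φ hr, min_eq_left hr', div_le_iff₀ (by positivity)]
  linarith

lemma tendsto_Phi_zero (hφcont : ContinuousOn φ (Icc 0 1)) (hφmono : StrictMonoOn φ (Icc 0 1))
    (hφzero : φ 0 = 0) (hI : IntegrableOn (fun s => s / φ s) (Ioo (0:ℝ) 1)) :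
    Tendsto (Phi φ) (nhdsWithin 0 (Ioi 0)) (nhds 0) := by
  have hφ : Tendsto φ (nhdsWithin 0 (Ioi 0)) (nhds 0) := by
    have h := (hφcont 0 ⟨le_rfl, zero_le_one⟩).mono_left
      (nhdsWithin_mono 0 (Ioc_subset_Icc_self (a := (0:ℝ)) (b := 1)))
    rwa [hφzero, nhdsWithin_Ioc_eq_nhdsGT zero_lt_one] at h
  have hev : ∀ᶠ r in nhdsWithin (0:ℝ) (Ioi 0), r ∈ Ioc (0:ℝ) 1 := Ioc_mem_nhdsGT zero_lt_one
  exact tendsto_of_tendsto_of_tendsto_of_le_of_le' tendsto_const_nhds hφ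
    (hev.mono fun r hr => (Phi_pos hφmono hφzero hI hr.1).le)
    (hev.mono fun r hr => Phi_le_self hφmono hφzero hI hr.1 hr.2)

lemma Phi_div_Phi_le_sq (hφmono : StrictMonoOn φ (Icc 0 1)) (hφzero : φ 0 = 0)
    (hI : IntegrableOn (fun s => s / φ s) (Ioo (0:ℝ) 1)) {r R : ℝ} (hr : 0 < r) (hrR : r ≤ R) :
    Phi φ R / Phi φ r ≤ (R / r) ^ 2 := by
  have hR := hr.trans_le hrR
  have hposr := integral_div_pos hφmono hφzero hI (lt_min hr one_pos) (min_le_right r 1)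
  have hle : ∫ s in (0:ℝ)..min r 1, s / φ s ≤ ∫ s in (0:ℝ)..min R 1, s / φ s := by
    refine intervalIntegral.integral_mono_interval le_rfl (le_min hr.le zero_le_one)
      (min_le_min_right 1 hrR) ?_
      (intervalIntegrable_div hI (lt_min hR one_pos) (min_le_right R 1))
    refine (ae_restrict_iff' measurableSet_Ioc).2 (Eventually.of_forall fun s hs => ?_)
    exact (div_pos hs.1 (pos_of_strictMonoOn_unit hφmono hφzero hs.1
      (hs.2.trans (min_le_right R 1)))).le
  rw [div_le_iff₀ (Phi_pos hφmono hφzero hI hr), Phi_eq_div_integral_min φ hr,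
    Phi_eq_div_integral_min φ hR]
  calc R ^ 2 / (2 * ∫ s in (0:ℝ)..min R 1, s / φ s)
      ≤ R ^ 2 / (2 * ∫ s in (0:ℝ)..min r 1, s / φ s) := by gcongr
    _ = (R / r) ^ 2 * (r ^ 2 / (2 * ∫ s in (0:ℝ)..min r 1, s / φ s)) := by field_simp

lemma le_Phi_div_Phi_of_le_one {a₁ α₁ : ℝ} (hφmono : StrictMonoOn φ (Icc 0 1))
    (hφzero : φ 0 = 0)
    (hLS : ∀ r R : ℝ, 0 < r → r ≤ R → R ≤ 1 → a₁ * (R / r) ^ α₁ ≤ φ R / φ r)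
    (hI : IntegrableOn (fun s => s / φ s) (Ioo (0:ℝ) 1))
    {r R : ℝ} (hr : 0 < r) (hrR : r ≤ R) (hR : R ≤ 1) :
    a₁ * (R / r) ^ α₁ ≤ Phi φ R / Phi φ r := by
  have hR0 := hr.trans_le hrR
  have hposR := integral_div_pos hφmono hφzero hI hR0 hR
  have hposr := integral_div_pos hφmono hφzero hI hr (hrR.trans hR)
  have hc : 1 ≤ R / r := (one_le_div hr).2 hrR
  have hle : ∫ s in (0:ℝ)..r, a₁ * (R / r) ^ α₁ * (s / φ (R / r * s))
      ≤ ∫ s in (0:ℝ)..r, s / φ s := by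
    refine intervalIntegral.integral_mono_on_of_le_Ioo hr.le
      ((intervalIntegrable_div_dilate hI hr hR0 hR).const_mul _)
      (intervalIntegrable_div hI hr (hrR.trans hR)) fun s hs => ?_
    have hs1 : R / r * s ≤ 1 := by
      calc R / r * s ≤ R / r * r := by gcongr; exact hs.2.le
        _ = R := div_mul_cancel₀ R hr.ne'
        _ ≤ 1 := hR
    have hs2 : s ≤ R / r * s := le_mul_of_one_le_left hs.1.le hc
    have h := hLS s (R / r * s) hs.1 hs2 hs1
    have hp := pos_of_strictMonoOn_unit hφmono hφzero (hs.1.trans_le hs2) hs1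
    have hs0 := hs.1
    rw [mul_div_cancel_right₀ _ hs0.ne'] at h
    calc a₁ * (R / r) ^ α₁ * (s / φ (R / r * s))
        ≤ φ (R / r * s) / φ s * (s / φ (R / r * s)) := by gcongr
      _ = s / φ s := by rw [div_mul_div_comm, mul_comm, mul_div_mul_right _ _ hp.ne']
  rw [intervalIntegral.integral_const_mul] at hle
  rw [le_div_iff₀ (Phi_pos hφmono hφzero hI hr), Phi_eq_div_integral_min φ hr,
    Phi_eq_div_integral_min φ hR0, min_eq_left hR, min_eq_left (hrR.trans hR)]
  rw [integral_div_eq_sq_mul_integral_dilate φ hr R] at hposR ⊢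
  have hpos := pos_of_mul_pos_right hposR (sq_nonneg (R / r))
  have e : R ^ 2 / (2 * ((R / r) ^ 2 * ∫ s in (0:ℝ)..r, s / φ (R / r * s)))
      = r ^ 2 / (2 * ∫ s in (0:ℝ)..r, s / φ (R / r * s)) := by
    field_simp
  rw [e, mul_div_assoc', div_le_div_iff₀ (by positivity) (by positivity)]
  nlinarith [mul_le_mul_of_nonneg_left hle (sq_nonneg r)]

lemma le_Phi_div_Phi {a₁ α₁ : ℝ} (hφmono : StrictMonoOn φ (Icc 0 1)) (hφzero : φ 0 = 0)
    (hα₁' : α₁ ≤ 2)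
    (hLS : ∀ r R : ℝ, 0 < r → r ≤ R → R ≤ 1 → a₁ * (R / r) ^ α₁ ≤ φ R / φ r)
    (hI : IntegrableOn (fun s => s / φ s) (Ioo (0:ℝ) 1))
    {r R : ℝ} (hr : 0 < r) (hrR : r ≤ R) :
    a₁ * (R / r) ^ α₁ ≤ Phi φ R / Phi φ r := by
  have hpow : ∀ x : ℝ, 1 ≤ x → x ^ α₁ ≤ x ^ 2 := fun x hx => by
    simpa using Real.rpow_le_rpow_of_exponent_le hx hα₁'
  have hbelow : ∀ {r R : ℝ}, 0 < r → r ≤ R → R ≤ 1 → a₁ * (R / r) ^ α₁ ≤ Phi φ R / Phi φ r :=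
    le_Phi_div_Phi_of_le_one hφmono hφzero hLS hI
  have hpos := Phi_pos hφmono hφzero hI one_pos
  rcases le_total R 1 with hR | hR
  · exact hbelow hr hrR hR
  rcases le_total r 1 with hr1 | hr1
  · have hposr := Phi_pos hφmono hφzero hI hr
    have hsplit : (R / r) ^ α₁ = (1 / r) ^ α₁ * R ^ α₁ := by
      rw [← Real.mul_rpow (by positivity) (by positivity)]
      ring_nf
    calc a₁ * (R / r) ^ α₁ = a₁ * (1 / r) ^ α₁ * R ^ α₁ := by rw [hsplit, mul_assoc]
      _ ≤ Phi φ 1 / Phi φ r * R ^ 2 := by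
        gcongr
        · exact hbelow hr hr1 le_rfl
        · exact hpow R hR
      _ = Phi φ R / Phi φ r := by rw [Phi_of_one_le φ hR]; ring
  · have ha : a₁ ≤ 1 := by
      simpa [hpos.ne'] using hbelow one_pos le_rfl le_rfl
    have hc : 1 ≤ R / r := (one_le_div hr).2 hrR
    calc a₁ * (R / r) ^ α₁ ≤ 1 * (R / r) ^ 2 := by
          gcongr
          exact hpow _ hc
      _ = Phi φ R / Phi φ r := by
        rw [Phi_of_one_le φ hR, Phi_of_one_le φ hr1]
        field_simp

end

/-- basic properties of Φ: continuity, strict monotonicity, Φ(0+) = 0,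
Φ ≤ φ on (0,1], and the two-sided weak scaling property. -/
theorem Phi_properties (φ : ℝ → ℝ) (a₁ α₁ : ℝ)
    (hφcont : ContinuousOn φ (Set.Icc 0 1))
    (hφmono : StrictMonoOn φ (Set.Icc 0 1))
    (hφzero : φ 0 = 0)
    (ha₁ : 0 < a₁) (hα₁ : 0 < α₁) (hα₁' : α₁ ≤ 2)
    (hLS : ∀ r R : ℝ, 0 < r → r ≤ R → R ≤ 1 → a₁ * (R / r) ^ α₁ ≤ φ R / φ r)
    (hI : MeasureTheory.IntegrableOn (fun s => s / φ s) (Set.Ioo (0:ℝ) 1)) :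
    ContinuousOn (Phi φ) (Set.Ioi 0)
    ∧ StrictMonoOn (Phi φ) (Set.Ioi 0)
    ∧ Filter.Tendsto (Phi φ) (nhdsWithin 0 (Set.Ioi 0)) (nhds 0)
    ∧ (∀ r : ℝ, 0 < r → r ≤ 1 → Phi φ r ≤ φ r)
    ∧ (∀ r R : ℝ, 0 < r → r ≤ R →
        a₁ * (R / r) ^ α₁ ≤ Phi φ R / Phi φ r ∧ Phi φ R / Phi φ r ≤ (R / r) ^ 2) := by
  exact ⟨continuousOn_Phi hφmono hφzero hI, strictMonoOn_Phi hφmono hφzero hI,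
    tendsto_Phi_zero hφcont hφmono hφzero hI,
    fun _ hr hr' => Phi_le_self hφmono hφzero hI hr hr',
    fun _ _ hr hrR => ⟨le_Phi_div_Phi hφmono hφzero hα₁' hLS hI hr hrR,
      Phi_div_Phi_le_sq hφmono hφzero hI hr hrR⟩⟩
end

section
/- Let γ, δ ≥ 0 and η, θ ∈ ℝ satisfy γ/2 + 1 − η > 0 and δ/2 + 1 − θ > 0. Then for every t > 0, ∫₀^t s^{−η} Φ⁻¹(s)^{γ} (t−s)^{−θ} Φ⁻¹(t−s)^{δ} ds ≤ B(δ/2 + 1 − θ, γ/2 + 1 − η) · t^{1−η−θ} Φ⁻¹(t)^{γ+δ}, where B(u,v) = ∫₀¹ s^{u−1}(1−s)^{v−1} ds is the Beta function. -/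
open MeasureTheory Filter Set

attribute [local instance] Classical.propDecidable

/-- The Beta function B(u,v) = ∫₀¹ s^{u-1} (1-s)^{v-1} ds. -/
noncomputable def BetaFn (u v : ℝ) : ℝ :=
  ∫ s in Set.Ioo (0:ℝ) 1, s ^ (u - 1) * (1 - s) ^ (v - 1)

/-- The real Beta integrand is integrable on the unit interval. -/
lemma integrableOn_beta {u v : ℝ} (hu : 0 < u) (hv : 0 < v) :
    IntegrableOn (fun x : ℝ => x ^ (u - 1) * (1 - x) ^ (v - 1)) (Ioo 0 1) := by
  have h := Complex.betaIntegral_convergent (u := (u : ℂ)) (v := (v : ℂ)) (by simpa) (by simpa)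
  rw [intervalIntegrable_iff_integrableOn_Ioo_of_le zero_le_one] at h
  refine (integrableOn_congr_fun (fun x hx => ?_) measurableSet_Ioo).mp h.re
  have hx1 : 0 ≤ 1 - x := by linarith [hx.2]
  have hc : (x : ℂ) ^ ((u : ℂ) - 1) * (1 - (x : ℂ)) ^ ((v : ℂ) - 1)
      = ((x ^ (u - 1) * (1 - x) ^ (v - 1) : ℝ) : ℂ) := by
    rw [Complex.ofReal_mul, Complex.ofReal_cpow hx.1.le, Complex.ofReal_cpow hx1]
    push_cast
    rfl
  simp [hc]

lemma phi_pos {φ : ℝ → ℝ} (hφmono : StrictMonoOn φ (Icc 0 1)) (hφzero : φ 0 = 0)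
    {s : ℝ} (h0 : 0 < s) (h1 : s ≤ 1) : 0 < φ s := by
  simpa [hφzero] using hφmono ⟨le_rfl, zero_le_one⟩ ⟨h0.le, h1⟩ h0

lemma setIntegral_div_phi_nonneg {φ : ℝ → ℝ} (hφmono : StrictMonoOn φ (Icc 0 1)) (hφzero : φ 0 = 0)
    {r : ℝ} (h1 : r ≤ 1) :
    0 ≤ ∫ s in Ioo (0 : ℝ) r, s / φ s :=
  setIntegral_nonneg measurableSet_Ioo fun _ hs =>
    div_nonneg hs.1.le (phi_pos hφmono hφzero hs.1 (hs.2.le.trans h1)).le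

lemma setIntegral_div_phi_mono {φ : ℝ → ℝ} (hφmono : StrictMonoOn φ (Icc 0 1)) (hφzero : φ 0 = 0)
    (hI : IntegrableOn (fun s => s / φ s) (Ioo (0 : ℝ) 1))
    {r R : ℝ} (hrR : r ≤ R) (h1 : R ≤ 1) :
    ∫ s in Ioo (0 : ℝ) r, s / φ s ≤ ∫ s in Ioo (0 : ℝ) R, s / φ s := by
  refine setIntegral_mono_set (hI.mono_set (Ioo_subset_Ioo_right h1)) ?_
    (Ioo_subset_Ioo_right hrR).eventuallyLE
  filter_upwards [ae_restrict_mem measurableSet_Ioo] with s hs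
  exact div_nonneg hs.1.le (phi_pos hφmono hφzero hs.1 (hs.2.le.trans h1)).le

/-- The map `r ↦ r⁻² ∫₀ʳ s / φ s ds` is nonincreasing on `(0, 1]`. -/
lemma sq_mul_setIntegral_div_phi_le {φ : ℝ → ℝ} (hφmono : StrictMonoOn φ (Icc 0 1)) (hφzero : φ 0 = 0)
    (hI : IntegrableOn (fun s => s / φ s) (Ioo (0 : ℝ) 1))
    {r R : ℝ} (h0 : 0 < r) (hrR : r ≤ R) (h1 : R ≤ 1) :
    r ^ 2 * ∫ s in Ioo (0 : ℝ) R, s / φ s ≤ R ^ 2 * ∫ s in Ioo (0 : ℝ) r, s / φ s := by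
  have hR : 0 < R := h0.trans_le hrR
  have hc : 0 < R / r := div_pos hR h0
  have hc1 : 1 ≤ R / r := (one_le_div h0).mpr hrR
  have hsub : ∫ s in Ioo (0 : ℝ) R, s / φ s
      = (R / r) * ∫ s in Ioo (0 : ℝ) r, (R / r * s) / φ (R / r * s) := by
    rw [← integral_Ioc_eq_integral_Ioo, ← integral_Ioc_eq_integral_Ioo,
      ← intervalIntegral.integral_of_le hR.le, ← intervalIntegral.integral_of_le h0.le,
      intervalIntegral.integral_comp_mul_left (fun s => s / φ s) hc.ne', mul_zero,
      div_mul_cancel₀ _ h0.ne', smul_eq_mul, mul_inv_cancel_left₀ hc.ne']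
  have hmem : ∀ s ∈ Ioo (0 : ℝ) r, 0 < R / r * s ∧ R / r * s ≤ 1 ∧ s ≤ R / r * s := by
    intro s hs
    refine ⟨mul_pos hc hs.1, ?_, le_mul_of_one_le_left hs.1.le hc1⟩
    calc R / r * s ≤ R / r * r := by gcongr; exact hs.2.le
      _ ≤ 1 := by rwa [div_mul_cancel₀ _ h0.ne']
  have hle : ∫ s in Ioo (0 : ℝ) r, (R / r * s) / φ (R / r * s)
      ≤ ∫ s in Ioo (0 : ℝ) r, R / r * (s / φ s) := by
    refine integral_mono_of_nonneg ?_
      ((hI.mono_set (Ioo_subset_Ioo_right (hrR.trans h1))).const_mul _) ?_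
    · filter_upwards [ae_restrict_mem measurableSet_Ioo] with s hs
      obtain ⟨hp, hp1, -⟩ := hmem s hs
      exact div_nonneg hp.le (phi_pos hφmono hφzero hp hp1).le
    · filter_upwards [ae_restrict_mem measurableSet_Ioo] with s hs
      obtain ⟨hp, hp1, hps⟩ := hmem s hs
      have hs1 : s ≤ 1 := hps.trans hp1
      have hφs := phi_pos hφmono hφzero hs.1 hs1
      have hφle : φ s ≤ φ (R / r * s) := hφmono.monotoneOn ⟨hs.1.le, hs1⟩ ⟨hp.le, hp1⟩ hps
      rw [← mul_div_assoc]
      gcongr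
  rw [integral_const_mul] at hle
  calc r ^ 2 * ∫ s in Ioo (0 : ℝ) R, s / φ s
      ≤ r ^ 2 * ((R / r) * (R / r * ∫ s in Ioo (0 : ℝ) r, s / φ s)) := by
        rw [hsub]; gcongr
    _ = R ^ 2 * ∫ s in Ioo (0 : ℝ) r, s / φ s := by field_simp

lemma Phi_eq (φ : ℝ → ℝ) (r : ℝ) :
    Phi φ r = r ^ 2 / (2 * ∫ s in Ioo (0 : ℝ) (min r 1), s / φ s) := by
  unfold Phi
  split_ifs with h
  · rw [min_eq_left h]
  · rw [min_eq_right (not_le.mp h).le]; ring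

/-- The inverse of `Φ` satisfies `Φ⁻¹(s) ≤ (s / t)^{1/2} Φ⁻¹(t)` for `s < t`. -/
lemma PhiInv_le {φ : ℝ → ℝ} (hφmono : StrictMonoOn φ (Icc 0 1)) (hφzero : φ 0 = 0)
    (hI : IntegrableOn (fun s => s / φ s) (Ioo (0 : ℝ) 1))
    {Φinv : ℝ → ℝ} (HΦ : PhiInvSpec φ Φinv) {s t : ℝ} (hs : 0 < s) (hst : s < t) :
    Φinv s ≤ (s / t) ^ (1 / 2 : ℝ) * Φinv t := by
  have ht : 0 < t := hs.trans hst
  have hr := HΦ.pos s hs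
  have hR := HΦ.pos t ht
  have hrs := HΦ.right_inv s hs
  have hRt := HΦ.right_inv t ht
  rw [Phi_eq] at hrs hRt
  set r := Φinv s
  set R := Φinv t
  set I : ℝ → ℝ := fun x => ∫ u in Ioo (0 : ℝ) x, u / φ u
  have hpos : ∀ x y : ℝ, 0 < y → x ^ 2 / (2 * I (min x 1)) = y → 0 < I (min x 1) := by
    intro x y hy hxy
    refine lt_of_le_of_ne (setIntegral_div_phi_nonneg hφmono hφzero (min_le_right _ _)) ?_
    intro h
    rw [← h] at hxy
    simp at hxy
    exact hy.ne hxy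
  have hIr := hpos r s hs hrs
  have hIR := hpos R t ht hRt
  change r ^ 2 / (2 * I (min r 1)) = s at hrs
  change R ^ 2 / (2 * I (min R 1)) = t at hRt
  have hrR : r ≤ R := by
    by_contra! hlt
    have hscale := sq_mul_setIntegral_div_phi_le hφmono hφzero hI (lt_min hR one_pos)
      (min_le_min_right 1 hlt.le) (min_le_right r 1)
    change min R 1 ^ 2 * I (min r 1) ≤ min r 1 ^ 2 * I (min R 1) at hscale
    have hkey : R ^ 2 * I (min r 1) ≤ r ^ 2 * I (min R 1) := by
      have hmm : max R 1 ≤ max r 1 := max_le_max_right 1 hlt.le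
      have hm0 : (0 : ℝ) ≤ max R 1 := zero_le_one.trans (le_max_right _ _)
      have e1 : R = min R 1 * max R 1 := by rw [min_mul_max, mul_one]
      have e2 : r = min r 1 * max r 1 := by rw [min_mul_max, mul_one]
      calc R ^ 2 * I (min r 1) = (max R 1) ^ 2 * (min R 1 ^ 2 * I (min r 1)) := by
            nth_rewrite 1 [e1]; ring
        _ ≤ (max r 1) ^ 2 * (min r 1 ^ 2 * I (min R 1)) := by gcongr
        _ = r ^ 2 * I (min R 1) := by nth_rewrite 3 [e2]; ring
    have : t ≤ s := by
      rw [← hrs, ← hRt, div_le_div_iff₀ (by positivity) (by positivity)]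
      linarith
    exact this.not_gt hst
  have hmono : I (min r 1) ≤ I (min R 1) :=
    setIntegral_div_phi_mono hφmono hφzero hI (min_le_min_right 1 hrR) (min_le_right _ _)
  have hr2 : r ^ 2 = s * (2 * I (min r 1)) := by rw [← hrs]; field_simp
  have hR2 : R ^ 2 = t * (2 * I (min R 1)) := by rw [← hRt]; field_simp
  rw [← Real.sqrt_eq_rpow]
  refine le_of_pow_le_pow_left₀ two_ne_zero (by positivity) ?_
  rw [mul_pow, Real.sq_sqrt (by positivity), hr2, hR2]
  calc s * (2 * I (min r 1)) ≤ s * (2 * I (min R 1)) := by gcongr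
    _ = s / t * (t * (2 * I (min R 1))) := by field_simp

/-- Powers of `Φ⁻¹`, weighted by a power of time, at a fraction of time `t`. -/
lemma rpow_mul_PhiInv_rpow_le {φ : ℝ → ℝ} (hφmono : StrictMonoOn φ (Icc 0 1)) (hφzero : φ 0 = 0)
    (hI : IntegrableOn (fun s => s / φ s) (Ioo (0 : ℝ) 1))
    {Φinv : ℝ → ℝ} (HΦ : PhiInvSpec φ Φinv) {t x : ℝ} (ht : 0 < t)
    (hx0 : 0 < x) (hx1 : x < 1) {γ : ℝ} (hγ : 0 ≤ γ) (η : ℝ) :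
    (t * x) ^ (-η) * Φinv (t * x) ^ γ ≤ x ^ (γ / 2 + 1 - η - 1) * (t ^ (-η) * Φinv t ^ γ) := by
  have hle := PhiInv_le hφmono hφzero hI HΦ (mul_pos ht hx0) (mul_lt_of_lt_one_right ht hx1)
  rw [mul_div_cancel_left₀ _ ht.ne'] at hle
  have hpos := HΦ.pos t ht
  calc (t * x) ^ (-η) * Φinv (t * x) ^ γ
      ≤ (t * x) ^ (-η) * (x ^ (1 / 2 : ℝ) * Φinv t) ^ γ := by
        have := (HΦ.pos _ (mul_pos ht hx0)).le
        gcongr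
    _ = x ^ (γ / 2 + 1 - η - 1) * (t ^ (-η) * Φinv t ^ γ) := by
        rw [Real.mul_rpow ht.le hx0.le, Real.mul_rpow (by positivity) hpos.le,
          ← Real.rpow_mul hx0.le,
          show γ / 2 + 1 - η - 1 = -η + 1 / 2 * γ by ring, Real.rpow_add hx0]
        ring

/-- convolution inequality for Φ⁻¹ involving the Beta function. -/
theorem PhiInv_convolution (φ : ℝ → ℝ) (a₁ α₁ : ℝ)
    (hφcont : ContinuousOn φ (Set.Icc 0 1))
    (hφmono : StrictMonoOn φ (Set.Icc 0 1))
    (hφzero : φ 0 = 0)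
    (ha₁ : 0 < a₁) (hα₁ : 0 < α₁) (hα₁' : α₁ ≤ 2)
    (hLS : ∀ r R : ℝ, 0 < r → r ≤ R → R ≤ 1 → a₁ * (R / r) ^ α₁ ≤ φ R / φ r)
    (hI : MeasureTheory.IntegrableOn (fun s => s / φ s) (Set.Ioo (0:ℝ) 1))
    (Φinv : ℝ → ℝ) (HΦ : PhiInvSpec φ Φinv)
    (γ δ η θ : ℝ) (hγ : 0 ≤ γ) (hδ : 0 ≤ δ)
    (h₁ : 0 < γ / 2 + 1 - η) (h₂ : 0 < δ / 2 + 1 - θ) :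
    ∀ t : ℝ, 0 < t →
      (∫ s in Set.Ioo (0:ℝ) t, s ^ (-η) * Φinv s ^ γ * (t - s) ^ (-θ) * Φinv (t - s) ^ δ)
        ≤ BetaFn (δ / 2 + 1 - θ) (γ / 2 + 1 - η) * t ^ (1 - η - θ) * Φinv t ^ (γ + δ) := by
  intro t ht
  set f : ℝ → ℝ := fun s => s ^ (-η) * Φinv s ^ γ * (t - s) ^ (-θ) * Φinv (t - s) ^ δ with hf
  have hpos := HΦ.pos t ht
  have hsub : ∫ s in Ioo (0 : ℝ) t, f s = t * ∫ x in Ioo (0 : ℝ) 1, f (t - t * x) := by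
    rw [← integral_Ioc_eq_integral_Ioo, ← integral_Ioc_eq_integral_Ioo,
      ← intervalIntegral.integral_of_le ht.le, ← intervalIntegral.integral_of_le zero_le_one,
      intervalIntegral.integral_comp_sub_mul f ht.ne', mul_zero, mul_one, sub_self, sub_zero,
      smul_eq_mul, mul_inv_cancel_left₀ ht.ne']
  have hle : ∫ x in Ioo (0 : ℝ) 1, f (t - t * x)
      ≤ ∫ x in Ioo (0 : ℝ) 1, x ^ (δ / 2 + 1 - θ - 1) * (1 - x) ^ (γ / 2 + 1 - η - 1) *
          ((t ^ (-η) * Φinv t ^ γ) * (t ^ (-θ) * Φinv t ^ δ)) := by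
    refine integral_mono_of_nonneg ?_ ((integrableOn_beta h₂ h₁).mul_const _) ?_
    · filter_upwards [ae_restrict_mem measurableSet_Ioo] with x hx
      have hy : 0 < t * x := mul_pos ht hx.1
      have hz : 0 < t - t * x := sub_pos.mpr (mul_lt_of_lt_one_right ht hx.2)
      have := HΦ.pos _ hy
      have := HΦ.pos _ hz
      simp only [hf, sub_sub_cancel, Pi.zero_apply]
      positivity
    · filter_upwards [ae_restrict_mem measurableSet_Ioo] with x hx
      have hx1 : 0 < 1 - x := sub_pos.mpr hx.2
      have hy : 0 < t * x := mul_pos ht hx.1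
      have hz : 0 < t * (1 - x) := mul_pos ht hx1
      have hΦy := HΦ.pos _ hy
      have hΦz := HΦ.pos _ hz
      have hA := rpow_mul_PhiInv_rpow_le hφmono hφzero hI HΦ ht hx1 (by linarith [hx.1]) hγ η
      have hB := rpow_mul_PhiInv_rpow_le hφmono hφzero hI HΦ ht hx.1 hx.2 hδ θ
      simp only [hf, sub_sub_cancel]
      rw [show t - t * x = t * (1 - x) by ring, mul_assoc (_ * _)]
      refine (mul_le_mul hA hB (by positivity) (by positivity)).trans_eq ?_
      ring
  rw [integral_mul_const] at hle
  rw [hsub]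
  refine (mul_le_mul_of_nonneg_left hle ht.le).trans_eq ?_
  rw [BetaFn, Real.rpow_add hpos, show 1 - η - θ = 1 + -η + -θ by ring, Real.rpow_add ht,
    Real.rpow_add ht, Real.rpow_one]
  ring
end

section
/- Let d ≥ 1, 0 < β < 1 and b > 0. Then there exists a constant c₁ > 0, depending only on b, d and β, such that for every x ∈ ℝ^d, ∫_{ℝ^d} exp(−b|x−z|^β − b|z|^β) dz ≤ c₁ exp(−b|x|^β). -/
open MeasureTheory Filter Set

/-- A quantitative form of the subadditivity of `t ↦ t ^ β` for `0 < β ≤ 1`. -/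
lemma add_rpow_le_two_rpow_mul_add {β s t : ℝ} (hβ : 0 < β) (hβ' : β ≤ 1) (hs : 0 ≤ s)
    (hst : s ≤ t) : (s + t) ^ β ≤ 2 ^ (β - 1) * s ^ β + t ^ β := by
  rcases hs.eq_or_lt with rfl | hs
  · simp [Real.zero_rpow hβ.ne']
  have ht : 0 < t := hs.trans_le hst
  have hβ₀ : β - 1 ≤ 0 := by linarith
  have split {u : ℝ} (hu : 0 < u) : u ^ β = u * u ^ (β - 1) := by
    rw [Real.rpow_sub_one hu.ne', mul_div_cancel₀ _ hu.ne']
  have h₁ : (s + t) ^ (β - 1) ≤ 2 ^ (β - 1) * s ^ (β - 1) := by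
    rw [← Real.mul_rpow zero_le_two hs.le]
    exact Real.rpow_le_rpow_of_nonpos (by positivity) (by linarith) hβ₀
  have h₂ : (s + t) ^ (β - 1) ≤ t ^ (β - 1) :=
    Real.rpow_le_rpow_of_nonpos ht (by linarith) hβ₀
  rw [split (add_pos hs ht), split hs, split ht]
  nlinarith [mul_le_mul_of_nonneg_left h₁ hs.le, mul_le_mul_of_nonneg_left h₂ ht.le]

lemma integrable_exp_neg_mul_norm_rpow {E : Type*} [NormedAddCommGroup E] [NormedSpace ℝ E]
    [FiniteDimensional ℝ E] [Nontrivial E] [MeasurableSpace E] [BorelSpace E]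
    (μ : Measure E) [μ.IsAddHaarMeasure] {a β : ℝ} (ha : 0 < a) (hβ : 0 < β) :
    Integrable (fun z : E => Real.exp (-a * ‖z‖ ^ β)) μ := by
  rw [integrable_fun_norm_addHaar μ (f := fun r => Real.exp (-a * r ^ β))]
  simpa using integrableOn_rpow_mul_exp_neg_mul_rpow
    (s := ((Module.finrank ℝ E - 1 : ℕ) : ℝ)) (neg_one_lt_zero.trans_le (Nat.cast_nonneg _)) hβ ha

lemma exp_neg_norm_rpow_mul_le {E : Type*} [SeminormedAddCommGroup E] {b β : ℝ} (hb : 0 ≤ b)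
    (hβ : 0 < β) (hβ' : β ≤ 1) (x z : E) :
    Real.exp (-b * ‖x - z‖ ^ β - b * ‖z‖ ^ β) ≤
      Real.exp (-b * ‖x‖ ^ β) * (Real.exp (-(b * (1 - 2 ^ (β - 1))) * ‖x - z‖ ^ β) +
        Real.exp (-(b * (1 - 2 ^ (β - 1))) * ‖z‖ ^ β)) := by
  have htri : ‖x‖ ^ β ≤ (‖x - z‖ + ‖z‖) ^ β :=
    Real.rpow_le_rpow (norm_nonneg x) (by simpa using norm_add_le (x - z) z) hβ.le
  rw [mul_add, ← Real.exp_add, ← Real.exp_add]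
  rcases le_total ‖x - z‖ ‖z‖ with h | h
  · have key := htri.trans (add_rpow_le_two_rpow_mul_add hβ hβ' (norm_nonneg _) h)
    refine le_add_of_le_of_nonneg (Real.exp_le_exp.2 ?_) (Real.exp_pos _).le
    linarith [mul_le_mul_of_nonneg_left key hb]
  · rw [add_comm ‖x - z‖] at htri
    have key := htri.trans (add_rpow_le_two_rpow_mul_add hβ hβ' (norm_nonneg _) h)
    refine le_add_of_nonneg_of_le (Real.exp_pos _).le (Real.exp_le_exp.2 ?_)
    linarith [mul_le_mul_of_nonneg_left key hb]

/-- subexponential convolution inequality. -/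
theorem exp_convolution (d : ℕ) (hd : 1 ≤ d) (b β : ℝ) (hb : 0 < b)
    (hβ : 0 < β) (hβ' : β < 1) :
    ∃ c₁ : ℝ, 0 < c₁ ∧ ∀ x : EuclideanSpace ℝ (Fin d),
      (∫ z : EuclideanSpace ℝ (Fin d),
          Real.exp (-b * ‖x - z‖ ^ β - b * ‖z‖ ^ β))
        ≤ c₁ * Real.exp (-b * ‖x‖ ^ β) := by
  have : Nonempty (Fin d) := ⟨⟨0, hd⟩⟩
  set a : ℝ := b * (1 - 2 ^ (β - 1))
  have ha : 0 < a := mul_pos hb <| sub_pos.2 <|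
    Real.rpow_lt_one_of_one_lt_of_neg one_lt_two (by linarith)
  set f : EuclideanSpace ℝ (Fin d) → ℝ := fun z => Real.exp (-a * ‖z‖ ^ β)
  have hf : Integrable f := integrable_exp_neg_mul_norm_rpow volume ha hβ
  have hf₀ : 0 ≤ ∫ z, f z := integral_nonneg fun z => (Real.exp_pos _).le
  refine ⟨2 * (∫ z, f z) + 1, by positivity, fun x => ?_⟩
  calc
    _ ≤ ∫ z, Real.exp (-b * ‖x‖ ^ β) * (f (x - z) + f z) :=
      integral_mono_of_nonneg (ae_of_all _ fun z => (Real.exp_pos _).le)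
        (((hf.comp_sub_left x).add hf).const_mul _)
        (ae_of_all _ fun z => exp_neg_norm_rpow_mul_le hb.le hβ hβ'.le x z)
    _ = 2 * (∫ z, f z) * Real.exp (-b * ‖x‖ ^ β) := by
      rw [integral_const_mul, integral_add (hf.comp_sub_left x) hf,
        integral_sub_left_eq_self f volume x]
      ring
    _ ≤ _ := by gcongr; linarith
end

section
/- Let d ≥ 1. There exists a constant c₂ > 0 depending only on d such that for every x ∈ ℝ^d with |x| ≥ 1, ∫_{ℝ^d} min(|x−z|^{−d−1}, 1) · min(|z|^{−d−1}, 1) dz ≤ c₂ |x|^{−d−1}. -/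
open MeasureTheory Filter Set

/-- A truncated negative power is dominated by the corresponding power of `(1 + t) / 2`. -/
lemma min_rpow_neg_one_le {t r : ℝ} (ht : 0 ≤ t) (hr : 0 ≤ r) :
    min (t ^ (-r)) 1 ≤ 2 ^ r * (1 + t) ^ (-r) := by
  have key : (2 : ℝ) ^ r * (1 + t) ^ (-r) = ((1 + t) / 2) ^ (-r) := by
    rw [Real.div_rpow (by positivity) (by norm_num), Real.rpow_neg (by norm_num : (0 : ℝ) ≤ 2),
      div_inv_eq_mul, mul_comm]
  rw [key]
  rcases le_total 1 t with h | h
  · exact (min_le_left _ _).trans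
      (Real.rpow_le_rpow_of_nonpos (by positivity) (by linarith) (by linarith))
  · exact (min_le_right _ _).trans
      (Real.one_le_rpow_of_pos_of_le_one_of_nonpos (by positivity) (by linarith) (by linarith))

/-- If `s ≤ a + b`, one of `a`, `b` is at least `s / 2`, so the product of the truncated powers
is controlled by `s ^ (-r)` times their sum. -/
lemma min_rpow_neg_mul_le {a b s r : ℝ} (ha : 0 ≤ a) (hb : 0 ≤ b) (hs : 0 < s) (hr : 0 ≤ r)
    (h : s ≤ a + b) :
    min (a ^ (-r)) 1 * min (b ^ (-r)) 1
      ≤ 2 ^ r * s ^ (-r) * (min (a ^ (-r)) 1 + min (b ^ (-r)) 1) := by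
  have key : (2 : ℝ) ^ r * s ^ (-r) = (s / 2) ^ (-r) := by
    rw [Real.div_rpow hs.le (by norm_num), Real.rpow_neg (by norm_num : (0 : ℝ) ≤ 2),
      div_inv_eq_mul, mul_comm]
  have hA : 0 ≤ min (a ^ (-r)) 1 := by positivity
  have hB : 0 ≤ min (b ^ (-r)) 1 := by positivity
  have hS : 0 ≤ (s / 2) ^ (-r) := by positivity
  have far {t : ℝ} (ht : s / 2 ≤ t) : min (t ^ (-r)) 1 ≤ (s / 2) ^ (-r) :=
    (min_le_left _ _).trans (Real.rpow_le_rpow_of_nonpos (by positivity) ht (by linarith))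
  rw [key]
  rcases le_total (s / 2) a with h1 | h1
  · nlinarith [mul_le_mul_of_nonneg_right (far h1) hB, mul_nonneg hS hA]
  · have h2 : s / 2 ≤ b := by linarith
    nlinarith [mul_le_mul_of_nonneg_left (far h2) hA, mul_nonneg hS hB]

/-- polynomial convolution inequality. -/
theorem poly_convolution (d : ℕ) (hd : 1 ≤ d) :
    ∃ c₂ : ℝ, 0 < c₂ ∧ ∀ x : EuclideanSpace ℝ (Fin d), 1 ≤ ‖x‖ →
      (∫ z : EuclideanSpace ℝ (Fin d),
          min (‖x - z‖ ^ (-(d : ℝ) - 1)) 1 * min (‖z‖ ^ (-(d : ℝ) - 1)) 1)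
        ≤ c₂ * ‖x‖ ^ (-(d : ℝ) - 1) := by
  obtain ⟨r, hr⟩ : ∃ r : ℝ, r = d + 1 := ⟨_, rfl⟩
  have hr0 : 0 ≤ r := by rw [hr]; positivity
  rw [show -(d : ℝ) - 1 = -r by rw [hr]; ring]
  let J : EuclideanSpace ℝ (Fin d) → ℝ := fun z => (1 + ‖z‖) ^ (-r)
  have hJ : Integrable J := integrable_one_add_norm (by simp [hr])
  have hJ0 : 0 ≤ ∫ z, J z := integral_nonneg fun z => by positivity
  refine ⟨2 ^ r * 2 ^ r * (2 * ∫ z, J z) + 1, by positivity, fun x hx => ?_⟩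
  have hJx : Integrable fun z => J (x - z) := hJ.comp_sub_left x
  have hx0 : 0 ≤ ‖x‖ ^ (-r) := by positivity
  calc _ ≤ ∫ z, 2 ^ r * ‖x‖ ^ (-r) * (2 ^ r * (J (x - z) + J z)) := by
        refine integral_mono_of_nonneg (.of_forall fun z => by positivity)
          (((hJx.add hJ).const_mul _).const_mul _) (.of_forall fun z => ?_)
        have htri : ‖x‖ ≤ ‖x - z‖ + ‖z‖ := by simpa using norm_add_le (x - z) z
        refine (min_rpow_neg_mul_le (norm_nonneg _) (norm_nonneg _) (by linarith) hr0 htri).trans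
          (mul_le_mul_of_nonneg_left ?_ (by positivity))
        rw [mul_add]
        exact add_le_add (min_rpow_neg_one_le (norm_nonneg _) hr0)
          (min_rpow_neg_one_le (norm_nonneg _) hr0)
    _ = 2 ^ r * 2 ^ r * (2 * ∫ z, J z) * ‖x‖ ^ (-r) := by
        rw [integral_const_mul, integral_const_mul, integral_add hJx hJ,
          integral_sub_left_eq_self J volume x]
        ring
    _ ≤ _ := by linarith
end

section
/- Assume ν satisfies (N1) and (N2). Then the characteristic exponent Ψ is comparable to φ̂(1/r)^{−1}: there exists a constant c > 0 such that c⁻¹ φ̂(r⁻¹)^{−1} ≤ Ψ(r) ≤ c φ̂(r⁻¹)^{−1} for all r > 0. In particular the Pruitt function 𝒫(r) := ∫_{ℝ^d} min(1, |z|²/r²) ν(|z|) dz satisfies c′⁻¹ φ̂(r)^{−1} ≤ 𝒫(r) ≤ c′ φ̂(r)^{−1} for all r > 0 and some constant c′ > 0. -/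
open MeasureTheory Filter Set

attribute [local instance] Classical.propDecidable

/-- `φ̂(r) = r² / ∫₀^r s^{d+1} ν(s) ds` for `0 < r ≤ 1`, and `φ̂(r) = φ̂(1) r²` for `r > 1`. -/
noncomputable def phiHat (d : ℕ) (ν : ℝ → ℝ) (r : ℝ) : ℝ :=
  if r ≤ 1 then r ^ 2 / ∫ s in Set.Ioo (0:ℝ) r, s ^ (d + 1) * ν s
  else (1 / ∫ s in Set.Ioo (0:ℝ) 1, s ^ (d + 1) * ν s) * r ^ 2

/-- `ν₁(r) = -ν′(r) / (2π r)`. -/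
noncomputable def nu1 (ν : ℝ → ℝ) (r : ℝ) : ℝ := -(deriv ν r) / (2 * Real.pi * r)

/-- The radial characteristic exponent of the symmetric Lévy measure `ν(|z|)dz`:
`ψ(ρ) = ∫_{ℝ^d} (1 - cos(ρ z₁)) ν(|z|) dz`. -/
noncomputable def psi (d : ℕ) (hd : 0 < d) (ν : ℝ → ℝ) (ρ : ℝ) : ℝ :=
  ∫ z : EuclideanSpace ℝ (Fin d), (1 - Real.cos (ρ * z ⟨0, hd⟩)) * ν ‖z‖

/-- `Ψ(r) = sup_{0 < s ≤ r} ψ(s)`. -/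
noncomputable def Psi (d : ℕ) (hd : 0 < d) (ν : ℝ → ℝ) (r : ℝ) : ℝ :=
  sSup (psi d hd ν '' Set.Ioc 0 r)

/-- Generalized inverse `Ψ⁻¹(u) = inf{s > 0 : Ψ(s) ≥ u}`. -/
noncomputable def PsiInv (d : ℕ) (hd : 0 < d) (ν : ℝ → ℝ) (u : ℝ) : ℝ :=
  sInf {s : ℝ | 0 < s ∧ u ≤ Psi d hd ν s}

/-- `f(r) = φ̂(1)/(r^{d+1} φ̂(r))` for `0 < r ≤ 1`, `f(r) = r^{-ℓ-1} e^{-b r^β}` for `r > 1`. -/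
noncomputable def ffun (d : ℕ) (ν : ℝ → ℝ) (b β ℓ : ℝ) (r : ℝ) : ℝ :=
  if r ≤ 1 then phiHat d ν 1 / (r ^ (d + 1) * phiHat d ν r)
  else r ^ (-ℓ - 1) * Real.exp (-b * r ^ β)

/-- `f̃(r) = φ̂(1)/(r^d φ̂(r))` for `0 < r ≤ 1`, `f̃(r) = r^{-ℓ} e^{-b r^β}` for `r > 1`. -/
noncomputable def ftil (d : ℕ) (ν : ℝ → ℝ) (b β ℓ : ℝ) (r : ℝ) : ℝ :=
  if r ≤ 1 then phiHat d ν 1 / (r ^ d * phiHat d ν r)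
  else r ^ (-ℓ) * Real.exp (-b * r ^ β)

structure NuAssumptions (d : ℕ) (ν : ℝ → ℝ) (a b β ℓ a₃ α₃ : ℝ) : Prop where
  ν_pos : ∀ r : ℝ, 0 < r → 0 < ν r
  ν_anti : AntitoneOn ν (Set.Ioi 0)
  ν_diff : ∀ r : ℝ, 0 < r → DifferentiableAt ℝ ν r
  ν_int : MeasureTheory.Integrable
      (fun y : EuclideanSpace ℝ (Fin d) => min 1 (‖y‖ ^ 2) * ν ‖y‖)
  ha : 0 < a
  hb : 0 < b
  β_pos : 0 < β
  β_le : β ≤ 1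
  ℓ_nonneg : 0 ≤ ℓ
  hN1 : ∀ r : ℝ, 1 < r → ν r ≤ a * r ^ (-ℓ) * Real.exp (-b * r ^ β)
  a₃_pos : 0 < a₃
  α₃_pos : 0 < α₃
  α₃_le : α₃ ≤ 2
  hN2 : ∀ r R : ℝ, 0 < r → r ≤ R → a₃ * (R / r) ^ α₃ ≤ phiHat d ν R / phiHat d ν r

/-- Multiplying by a measurable function dominated by an integrable weight preserves
integrability, with no measurability assumption on the common factor. -/
lemma integrable_mul_of_abs_le {X : Type*} [MeasurableSpace X] {μ : Measure X}
    {q m n : X → ℝ} {C : ℝ} (hq : Measurable q) (hm : Measurable m)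
    (hm0 : ∀ x, 0 ≤ m x) (hle : ∀ x, |q x| ≤ C * m x)
    (hint : Integrable (fun x => m x * n x) μ) : Integrable (fun x => q x * n x) μ := by
  have h := hint.bdd_mul (c := |C|) (f := fun x => q x / m x)
    (hq.div hm).aestronglyMeasurable (Eventually.of_forall fun x => by
      rw [Real.norm_eq_abs, abs_div, abs_of_nonneg (hm0 x)]
      exact div_le_of_le_mul₀ (hm0 x) (abs_nonneg C)
        ((hle x).trans (mul_le_mul_of_nonneg_right (le_abs_self C) (hm0 x))))
  refine h.congr (Eventually.of_forall fun x => ?_)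
  rcases eq_or_ne (m x) 0 with h0 | h0
  · have : q x = 0 := by simpa [h0] using hle x
    simp [this]
  · simp only
    field_simp

/-- The surface measure of the unit sphere of `ℝ^d`. -/
noncomputable def sphereArea (d : ℕ) : ℝ :=
  d * (volume : Measure (EuclideanSpace ℝ (Fin d))).real (Metric.ball 0 1)

lemma sphereArea_pos {d : ℕ} (hd : 0 < d) : 0 < sphereArea d :=
  mul_pos (by exact_mod_cast hd)
    (ENNReal.toReal_pos (Metric.measure_ball_pos _ _ one_pos).ne' measure_ball_lt_top.ne)

lemma integral_radial {d : ℕ} (hd : 0 < d) (f : ℝ → ℝ) :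
    ∫ z : EuclideanSpace ℝ (Fin d), f ‖z‖
      = sphereArea d * ∫ y in Ioi (0 : ℝ), y ^ (d - 1) * f y := by
  have : Nonempty (Fin d) := ⟨⟨0, hd⟩⟩
  rw [integral_fun_norm_addHaar volume f]
  simp [sphereArea, mul_assoc]

lemma integrable_radial {d : ℕ} (hd : 0 < d) {f : ℝ → ℝ} :
    Integrable (fun z : EuclideanSpace ℝ (Fin d) => f ‖z‖)
      ↔ IntegrableOn (fun y : ℝ => y ^ (d - 1) * f y) (Ioi 0) := by
  have : Nonempty (Fin d) := ⟨⟨0, hd⟩⟩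
  rw [integrable_fun_norm_addHaar volume]
  simp

lemma pow_pred_mul_sq {d : ℕ} (hd : 0 < d) (y : ℝ) : y ^ (d - 1) * y ^ 2 = y ^ (d + 1) := by
  rw [← pow_add]
  congr 1
  omega

lemma coord_sq_le_norm_sq {d : ℕ} (z : EuclideanSpace ℝ (Fin d)) (i : Fin d) :
    z i ^ 2 ≤ ‖z‖ ^ 2 := by
  rw [EuclideanSpace.real_norm_sq_eq]
  exact Finset.single_le_sum (f := fun k => z k ^ 2) (fun k _ => sq_nonneg _) (Finset.mem_univ i)

/-- By rotational symmetry every coordinate carries the same share of the second moment. -/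
lemma integral_coord_sq {d : ℕ} (i : Fin d) (g : ℝ → ℝ)
    (hg : Integrable fun z : EuclideanSpace ℝ (Fin d) => ‖z‖ ^ 2 * g ‖z‖) :
    (d : ℝ) * ∫ z : EuclideanSpace ℝ (Fin d), z i ^ 2 * g ‖z‖
      = ∫ z : EuclideanSpace ℝ (Fin d), ‖z‖ ^ 2 * g ‖z‖ := by
  have hint : ∀ j : Fin d,
      Integrable fun z : EuclideanSpace ℝ (Fin d) => z j ^ 2 * g ‖z‖ := fun j =>
    integrable_mul_of_abs_le (C := 1) (by fun_prop) (by fun_prop) (fun z => by positivity)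
      (fun z => by
        rw [abs_of_nonneg (sq_nonneg _), one_mul]
        exact coord_sq_le_norm_sq z j) hg
  have hswap : ∀ j : Fin d, ∫ z : EuclideanSpace ℝ (Fin d), z j ^ 2 * g ‖z‖
      = ∫ z : EuclideanSpace ℝ (Fin d), z i ^ 2 * g ‖z‖ := by
    intro j
    let e := LinearIsometryEquiv.piLpCongrLeft 2 ℝ ℝ (Equiv.swap i j)
    rw [← e.measurePreserving.integral_comp e.toHomeomorph.measurableEmbedding
      (fun z : EuclideanSpace ℝ (Fin d) => z i ^ 2 * g ‖z‖)]
    refine integral_congr_ae (Eventually.of_forall fun z => ?_)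
    simp [e, LinearIsometryEquiv.piLpCongrLeft_apply, Equiv.piCongrLeft']
  simp_rw [EuclideanSpace.real_norm_sq_eq, Finset.sum_mul]
  rw [integral_finsetSum _ fun j _ => by simpa only using hint j]
  simp [hswap]

/-- The truncated second moment `∫₀^r s^{d+1} ν(s) ds`. -/
noncomputable def truncMoment (d : ℕ) (ν : ℝ → ℝ) (r : ℝ) : ℝ :=
  ∫ s in Ioo (0 : ℝ) r, s ^ (d + 1) * ν s

namespace NuAssumptions

variable {d : ℕ} {ν : ℝ → ℝ} {a b β ℓ a₃ α₃ : ℝ}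

lemma integrableOn_moment (H : NuAssumptions d ν a b β ℓ a₃ α₃) (hd : 0 < d) :
    IntegrableOn (fun s => s ^ (d + 1) * ν s) (Ioi 0) := by
  rw [← Ioc_union_Ioi_eq_Ioi (zero_le_one' ℝ)]
  refine IntegrableOn.union ?_ ?_
  · have h := (integrable_radial hd (f := fun t => min 1 (t ^ 2) * ν t)).1 H.ν_int
    refine (h.mono_set Ioc_subset_Ioi_self).congr_fun (fun s hs => ?_) measurableSet_Ioc
    have : s ^ 2 ≤ 1 := pow_le_one₀ hs.1.le hs.2
    simp only [min_eq_right this]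
    rw [← mul_assoc, pow_pred_mul_sq hd]
  · have h : IntegrableOn (fun s : ℝ => a * (s ^ ((d : ℝ) + 1) * Real.exp (-b * s ^ β)))
        (Ioi 1) :=
      ((integrableOn_rpow_mul_exp_neg_mul_rpow (neg_one_lt_zero.trans (by positivity))
        H.β_pos H.hb).mono_set (Ioi_subset_Ioi zero_le_one)).const_mul a
    refine Integrable.mono' h ?_ ?_
    · refine AEStronglyMeasurable.mul (by fun_prop) ?_
      exact (aemeasurable_restrict_of_antitoneOn measurableSet_Ioi
        (H.ν_anti.mono (Ioi_subset_Ioi zero_le_one))).aestronglyMeasurable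
    · refine (ae_restrict_iff' measurableSet_Ioi).2 (Eventually.of_forall fun s hs => ?_)
      have hs1 : (1 : ℝ) < s := hs
      have hs0 : 0 < s := zero_lt_one.trans hs1
      have hν := H.ν_pos s hs0
      have hℓ : s ^ (-ℓ) ≤ 1 :=
        Real.rpow_le_one_of_one_le_of_nonpos hs1.le (neg_nonpos.2 H.ℓ_nonneg)
      have hpow : s ^ ((d : ℝ) + 1) = s ^ (d + 1) := by exact_mod_cast Real.rpow_natCast s (d + 1)
      have ha := H.ha
      rw [Real.norm_of_nonneg (by positivity), hpow]
      calc s ^ (d + 1) * ν s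
          ≤ s ^ (d + 1) * (a * s ^ (-ℓ) * Real.exp (-b * s ^ β)) := by
            gcongr
            exact H.hN1 s hs1
        _ ≤ s ^ (d + 1) * (a * 1 * Real.exp (-b * s ^ β)) := by gcongr
        _ = a * (s ^ (d + 1) * Real.exp (-b * s ^ β)) := by ring

lemma integrable_sq_norm_mul (H : NuAssumptions d ν a b β ℓ a₃ α₃) (hd : 0 < d) :
    Integrable fun z : EuclideanSpace ℝ (Fin d) => ‖z‖ ^ 2 * ν ‖z‖ := by
  refine (integrable_radial hd (f := fun t => t ^ 2 * ν t)).2 ?_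
  simpa only [← mul_assoc, pow_pred_mul_sq hd] using H.integrableOn_moment hd

lemma truncMoment_mono (H : NuAssumptions d ν a b β ℓ a₃ α₃) (hd : 0 < d) {r R : ℝ}
    (hrR : r ≤ R) : truncMoment d ν r ≤ truncMoment d ν R := by
  refine setIntegral_mono_set ((H.integrableOn_moment hd).mono_set Ioo_subset_Ioi_self) ?_
    (Ioo_subset_Ioo_right hrR).eventuallyLE
  refine (ae_restrict_iff' measurableSet_Ioo).2 (Eventually.of_forall fun s hs => ?_)
  exact mul_nonneg (pow_nonneg hs.1.le _) (H.ν_pos s hs.1).le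

lemma truncMoment_le (H : NuAssumptions d ν a b β ℓ a₃ α₃) (hd : 0 < d) (r : ℝ) :
    truncMoment d ν r ≤ ∫ s in Ioi (0 : ℝ), s ^ (d + 1) * ν s := by
  refine setIntegral_mono_set (H.integrableOn_moment hd) ?_ Ioo_subset_Ioi_self.eventuallyLE
  refine (ae_restrict_iff' measurableSet_Ioi).2 (Eventually.of_forall fun s hs => ?_)
  exact mul_nonneg (pow_nonneg (le_of_lt hs) _) (H.ν_pos s hs).le

/-- Monotonicity of `ν` bounds its value at `r` by the truncated second moment. -/
lemma pow_mul_le_truncMoment (H : NuAssumptions d ν a b β ℓ a₃ α₃) (hd : 0 < d) {r : ℝ}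
    (hr : 0 < r) : r ^ (d + 2) * ν r ≤ (d + 2) * truncMoment d ν r := by
  have h : ∫ s in Ioo (0 : ℝ) r, s ^ (d + 1) * ν r ≤ truncMoment d ν r := by
    refine setIntegral_mono_on ?_ ((H.integrableOn_moment hd).mono_set Ioo_subset_Ioi_self)
      measurableSet_Ioo fun s hs => ?_
    · exact (Continuous.integrableOn_Icc (by fun_prop)).mono_set Ioo_subset_Icc_self
    · exact mul_le_mul_of_nonneg_left (H.ν_anti hs.1 hr hs.2.le) (pow_nonneg hs.1.le _)
  rw [← integral_Ioc_eq_integral_Ioo, ← intervalIntegral.integral_of_le hr.le,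
    intervalIntegral.integral_mul_const, integral_pow] at h
  have hd2 : (0 : ℝ) < d + 2 := by positivity
  calc r ^ (d + 2) * ν r
      = (d + 2) * ((r ^ (d + 1 + 1) - 0 ^ (d + 1 + 1)) / (((d + 1 : ℕ) : ℝ) + 1) * ν r) := by
        push_cast
        rw [zero_pow (by omega)]
        field_simp
        ring
    _ ≤ _ := by gcongr

lemma truncMoment_pos (H : NuAssumptions d ν a b β ℓ a₃ α₃) (hd : 0 < d) {r : ℝ}
    (hr : 0 < r) : 0 < truncMoment d ν r := by
  have h := H.pow_mul_le_truncMoment hd hr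
  have := mul_pos (pow_pos hr (d + 2)) (H.ν_pos r hr)
  exact pos_of_mul_pos_right (this.trans_le h) (by positivity)

lemma phiHat_pos (H : NuAssumptions d ν a b β ℓ a₃ α₃) (hd : 0 < d) {r : ℝ}
    (hr : 0 < r) : 0 < phiHat d ν r := by
  have h1 := H.truncMoment_pos hd hr
  have h2 := H.truncMoment_pos hd one_pos
  unfold truncMoment at h1 h2
  unfold phiHat
  split_ifs <;> positivity

lemma phiHat_inv_le (H : NuAssumptions d ν a b β ℓ a₃ α₃) (hd : 0 < d) {r : ℝ}
    (hr : 0 < r) : (phiHat d ν r)⁻¹ ≤ truncMoment d ν r / r ^ 2 := by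
  unfold phiHat
  split_ifs with h
  · rw [inv_div, truncMoment]
  · rw [mul_inv, one_div, inv_inv, ← div_eq_mul_inv]
    gcongr
    exact H.truncMoment_mono hd (not_le.1 h).le

/-- For `r > 1` the truncated moment exceeds `∫₀¹ s^{d+1} ν(s) ds` by at most a constant factor. -/
lemma exists_truncMoment_le (H : NuAssumptions d ν a b β ℓ a₃ α₃) (hd : 0 < d) :
    ∃ A : ℝ, 0 < A ∧ ∀ r : ℝ, 0 < r → truncMoment d ν r / r ^ 2 ≤ A * (phiHat d ν r)⁻¹ := by
  have h1 := H.truncMoment_pos hd one_pos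
  have hM := H.truncMoment_le hd
  set M := ∫ s in Ioi (0 : ℝ), s ^ (d + 1) * ν s
  have hA : 1 ≤ M / truncMoment d ν 1 := (one_le_div h1).2 (hM 1)
  refine ⟨M / truncMoment d ν 1, zero_lt_one.trans_le hA, fun r hr => ?_⟩
  have hr' := H.truncMoment_pos hd hr
  unfold phiHat
  split_ifs with h
  · rw [inv_div]
    exact le_mul_of_one_le_left (by positivity) hA
  · rw [mul_inv, one_div, inv_inv, ← mul_assoc]
    change _ ≤ M / truncMoment d ν 1 * truncMoment d ν 1 * _
    rw [div_mul_cancel₀ _ h1.ne', ← div_eq_mul_inv]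
    gcongr
    exact hM r

lemma phiHat_inv_decay (H : NuAssumptions d ν a b β ℓ a₃ α₃) (hd : 0 < d) {r s : ℝ}
    (hr : 0 < r) (hrs : r ≤ s) :
    (phiHat d ν s)⁻¹ ≤ a₃⁻¹ * (phiHat d ν r)⁻¹ * (r ^ α₃ * s ^ (-α₃)) := by
  have hs := hr.trans_le hrs
  have h := H.hN2 r s hr hrs
  have hφr := H.phiHat_pos hd hr
  have hφs := H.phiHat_pos hd hs
  have ha := H.a₃_pos
  have hrp : 0 < r ^ α₃ := Real.rpow_pos_of_pos hr _
  have hsp : 0 < s ^ α₃ := Real.rpow_pos_of_pos hs _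
  rw [Real.div_rpow hs.le hr.le, le_div_iff₀ hφr] at h
  rw [Real.rpow_neg hs.le]
  calc (phiHat d ν s)⁻¹ ≤ (a₃ * (s ^ α₃ / r ^ α₃) * phiHat d ν r)⁻¹ :=
        inv_anti₀ (by positivity) h
    _ = _ := by field_simp

lemma integrable_pruitt (H : NuAssumptions d ν a b β ℓ a₃ α₃) (hd : 0 < d) (r : ℝ) :
    Integrable fun z : EuclideanSpace ℝ (Fin d) => min 1 (‖z‖ ^ 2 / r ^ 2) * ν ‖z‖ := by
  refine integrable_mul_of_abs_le (C := (r ^ 2)⁻¹) (by fun_prop) (by fun_prop)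
    (fun z => by positivity) (fun z => ?_) (H.integrable_sq_norm_mul hd)
  rw [abs_of_nonneg (by positivity), ← div_eq_inv_mul]
  exact min_le_right _ _

lemma pruitt_eq (hd : 0 < d) (r : ℝ) :
    ∫ z : EuclideanSpace ℝ (Fin d), min 1 (‖z‖ ^ 2 / r ^ 2) * ν ‖z‖
      = sphereArea d * ∫ s in Ioi (0 : ℝ), s ^ (d - 1) * (min 1 (s ^ 2 / r ^ 2) * ν s) :=
  integral_radial hd fun t => min 1 (t ^ 2 / r ^ 2) * ν t

lemma integrableOn_pruitt (H : NuAssumptions d ν a b β ℓ a₃ α₃) (hd : 0 < d) (r : ℝ) :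
    IntegrableOn (fun s : ℝ => s ^ (d - 1) * (min 1 (s ^ 2 / r ^ 2) * ν s)) (Ioi 0) :=
  (integrable_radial hd (f := fun t => min 1 (t ^ 2 / r ^ 2) * ν t)).1 (H.integrable_pruitt hd r)

lemma integral_Ioo_pruitt (hd : 0 < d) {r : ℝ} (hr : 0 < r) :
    ∫ s in Ioo (0 : ℝ) r, s ^ (d - 1) * (min 1 (s ^ 2 / r ^ 2) * ν s)
      = truncMoment d ν r / r ^ 2 := by
  rw [truncMoment, ← integral_div]
  refine setIntegral_congr_fun measurableSet_Ioo fun s hs => ?_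
  have : s ^ 2 / r ^ 2 ≤ 1 := by
    rw [div_le_one (by positivity)]
    exact pow_le_pow_left₀ hs.1.le hs.2.le 2
  simp only [min_eq_right this, ← pow_pred_mul_sq hd]
  ring

lemma phiHat_inv_le_pruitt (H : NuAssumptions d ν a b β ℓ a₃ α₃) (hd : 0 < d) {r : ℝ}
    (hr : 0 < r) : sphereArea d * (phiHat d ν r)⁻¹
      ≤ ∫ z : EuclideanSpace ℝ (Fin d), min 1 (‖z‖ ^ 2 / r ^ 2) * ν ‖z‖ := by
  rw [pruitt_eq hd]
  refine mul_le_mul_of_nonneg_left ((H.phiHat_inv_le hd hr).trans ?_) (sphereArea_pos hd).le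
  rw [← integral_Ioo_pruitt hd hr]
  refine setIntegral_mono_set (H.integrableOn_pruitt hd r) ?_ Ioo_subset_Ioi_self.eventuallyLE
  refine (ae_restrict_iff' measurableSet_Ioi).2 (Eventually.of_forall fun s hs => ?_)
  have := H.ν_pos s hs
  have : 0 < s := hs
  simp only [Pi.zero_apply]
  positivity

lemma exists_pruitt_le (H : NuAssumptions d ν a b β ℓ a₃ α₃) (hd : 0 < d) :
    ∃ c : ℝ, ∀ r : ℝ, 0 < r →
      ∫ z : EuclideanSpace ℝ (Fin d), min 1 (‖z‖ ^ 2 / r ^ 2) * ν ‖z‖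
        ≤ c * (phiHat d ν r)⁻¹ := by
  obtain ⟨A, hA, hAle⟩ := H.exists_truncMoment_le hd
  have hS := sphereArea_pos hd
  have ha := H.a₃_pos
  have hα := H.α₃_pos
  refine ⟨sphereArea d * (A + (d + 2) * A * a₃⁻¹ * α₃⁻¹), fun r hr => ?_⟩
  have hP := H.integrableOn_pruitt hd r
  rw [pruitt_eq hd, mul_assoc]
  refine mul_le_mul_of_nonneg_left ?_ hS.le
  have hφ := H.phiHat_pos hd hr
  have htail : ∫ s in Ici r, s ^ (d - 1) * (min 1 (s ^ 2 / r ^ 2) * ν s)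
      ≤ (d + 2) * A * a₃⁻¹ * α₃⁻¹ * (phiHat d ν r)⁻¹ := by
    rw [integral_Ici_eq_integral_Ioi]
    have hlt : -1 - α₃ < -1 := by linarith
    calc ∫ s in Ioi r, s ^ (d - 1) * (min 1 (s ^ 2 / r ^ 2) * ν s)
        ≤ ∫ s in Ioi r, ((d + 2) * A * a₃⁻¹ * (phiHat d ν r)⁻¹ * r ^ α₃) * s ^ (-1 - α₃) := by
          refine setIntegral_mono_on (hP.mono_set (Ioi_subset_Ioi hr.le))
            ((integrableOn_Ioi_rpow_of_lt hlt hr).const_mul _) measurableSet_Ioi fun s hs => ?_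
          have hs0 : 0 < s := hr.trans hs
          have hν := H.ν_pos s hs0
          have hsν : s ^ (d - 1) * ν s ≤ (d + 2) * (truncMoment d ν s / s ^ 2) * s⁻¹ := by
            have h := H.pow_mul_le_truncMoment hd hs0
            have hp : s ^ (d + 2) = s ^ (d - 1) * s ^ 3 := by
              rw [← pow_add]
              congr 1
              omega
            rw [hp] at h
            calc s ^ (d - 1) * ν s = s ^ (d - 1) * s ^ 3 * ν s / s ^ 3 := by field_simp
              _ ≤ (d + 2) * truncMoment d ν s / s ^ 3 := by gcongr
              _ = _ := by field_simp
          calc s ^ (d - 1) * (min 1 (s ^ 2 / r ^ 2) * ν s) ≤ s ^ (d - 1) * (1 * ν s) := by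
                gcongr
                exact min_le_left _ _
            _ = s ^ (d - 1) * ν s := by rw [one_mul]
            _ ≤ (d + 2) * (truncMoment d ν s / s ^ 2) * s⁻¹ := hsν
            _ ≤ (d + 2) * (A * (a₃⁻¹ * (phiHat d ν r)⁻¹ * (r ^ α₃ * s ^ (-α₃)))) * s⁻¹ := by
                gcongr
                refine (hAle s hs0).trans ?_
                gcongr
                exact H.phiHat_inv_decay hd hr (le_of_lt hs)
            _ = _ := by
                rw [show -1 - α₃ = -α₃ + -1 by ring, Real.rpow_add hs0, Real.rpow_neg_one]
                ring
      _ = _ := by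
          rw [integral_const_mul, integral_Ioi_rpow_of_lt hlt hr,
            show -1 - α₃ + 1 = -α₃ by ring, Real.rpow_neg hr.le]
          have : 0 < r ^ α₃ := Real.rpow_pos_of_pos hr _
          field_simp
  rw [← Ioo_union_Ici_eq_Ioi hr, setIntegral_union (by
      rw [Set.disjoint_left]
      exact fun s hs hs' => not_lt.2 hs' hs.2) measurableSet_Ici
    (hP.mono_set Ioo_subset_Ioi_self) (hP.mono_set (Ici_subset_Ioi.2 hr)),
    integral_Ioo_pruitt hd hr, add_mul]
  exact add_le_add (hAle r hr) htail

lemma psi_le (H : NuAssumptions d ν a b β ℓ a₃ α₃) (hd : 0 < d) {r s : ℝ} (hs : 0 < s)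
    (hsr : s ≤ r) : psi d hd ν s
      ≤ 2 * ∫ z : EuclideanSpace ℝ (Fin d), min 1 (‖z‖ ^ 2 / r⁻¹ ^ 2) * ν ‖z‖ := by
  rw [psi, ← integral_const_mul]
  have hν : ∀ z : EuclideanSpace ℝ (Fin d), z = 0 ∨ 0 < ν ‖z‖ := fun z =>
    (eq_or_ne z 0).imp_right fun h => H.ν_pos _ (norm_pos_iff.2 h)
  refine integral_mono_of_nonneg (Eventually.of_forall fun z => ?_)
    ((H.integrable_pruitt hd r⁻¹).const_mul 2) (Eventually.of_forall fun z => ?_)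
  · rcases hν z with rfl | h
    · simp
    · exact mul_nonneg (sub_nonneg.2 (Real.cos_le_one _)) h.le
  · rcases hν z with rfl | h
    · simp
    · simp only
      rw [← mul_assoc]
      refine mul_le_mul_of_nonneg_right ?_ h.le
      have hz := coord_sq_le_norm_sq z ⟨0, hd⟩
      have h1 : 1 - Real.cos (s * z ⟨0, hd⟩) ≤ 2 := by
        linarith [Real.neg_one_le_cos (s * z ⟨0, hd⟩)]
      have h2 := Real.one_sub_sq_div_two_le_cos (x := s * z ⟨0, hd⟩)
      have h3 : (s * z ⟨0, hd⟩) ^ 2 ≤ ‖z‖ ^ 2 * r ^ 2 := by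
        rw [mul_pow, mul_comm]
        gcongr
      have h4 : 0 ≤ ‖z‖ ^ 2 * r ^ 2 := by positivity
      rw [inv_pow, div_inv_eq_mul]
      rcases min_cases 1 (‖z‖ ^ 2 * r ^ 2) with ⟨h, _⟩ | ⟨h, _⟩ <;> rw [h] <;> linarith

lemma le_psi (H : NuAssumptions d ν a b β ℓ a₃ α₃) (hd : 0 < d) {r : ℝ} (hr : 0 < r) :
    2 / Real.pi ^ 2 * (sphereArea d / d) * (phiHat d ν r⁻¹)⁻¹ ≤ psi d hd ν r := by
  have hr' : 0 < r⁻¹ := inv_pos.2 hr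
  have hd' : (0 : ℝ) < d := by exact_mod_cast hd
  let g : ℝ → ℝ := (Iio r⁻¹).indicator ν
  have hg : Integrable fun z : EuclideanSpace ℝ (Fin d) => ‖z‖ ^ 2 * g ‖z‖ := by
    have h := (H.integrable_sq_norm_mul hd).indicator
      (measurableSet_lt measurable_norm (measurable_const (a := r⁻¹)))
    refine h.congr (Eventually.of_forall fun z => ?_)
    by_cases hz : ‖z‖ < r⁻¹ <;> simp [g, hz]
  have hmoment : ∫ z : EuclideanSpace ℝ (Fin d), ‖z‖ ^ 2 * g ‖z‖
      = sphereArea d * truncMoment d ν r⁻¹ := by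
    rw [integral_radial hd fun t => t ^ 2 * g t, truncMoment, ← Ioi_inter_Iio,
      ← setIntegral_indicator measurableSet_Iio]
    congr 1
    refine integral_congr_ae (Eventually.of_forall fun s => ?_)
    by_cases hs : s < r⁻¹ <;> simp [g, hs, ← mul_assoc, pow_pred_mul_sq hd]
  have hcoord := integral_coord_sq ⟨0, hd⟩ g hg
  have hpsi : Integrable fun z : EuclideanSpace ℝ (Fin d) =>
      (1 - Real.cos (r * z ⟨0, hd⟩)) * ν ‖z‖ := by
    refine integrable_mul_of_abs_le (C := r ^ 2 / 2) (by fun_prop) (by fun_prop)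
      (fun z => by positivity) (fun z => ?_) (H.integrable_sq_norm_mul hd)
    have hz := coord_sq_le_norm_sq z ⟨0, hd⟩
    rw [abs_of_nonneg (sub_nonneg.2 (Real.cos_le_one _))]
    have h2 := Real.one_sub_sq_div_two_le_cos (x := r * z ⟨0, hd⟩)
    have h3 : r ^ 2 * z ⟨0, hd⟩ ^ 2 ≤ r ^ 2 * ‖z‖ ^ 2 := by gcongr
    rw [mul_pow] at h2
    linarith
  have hlow : ∫ z : EuclideanSpace ℝ (Fin d),
      2 / Real.pi ^ 2 * r ^ 2 * (z ⟨0, hd⟩ ^ 2 * g ‖z‖) ≤ psi d hd ν r := by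
    refine integral_mono_of_nonneg (Eventually.of_forall fun z => ?_) hpsi
      (Eventually.of_forall fun z => ?_)
    all_goals
      rcases eq_or_ne z 0 with rfl | hz0
      · simp
      have hν := H.ν_pos _ (norm_pos_iff.2 hz0)
    · have : 0 ≤ g ‖z‖ := by
        by_cases hz : ‖z‖ < r⁻¹ <;> simp [g, hz, hν.le]
      simp only [Pi.zero_apply]
      positivity
    · by_cases hz : ‖z‖ < r⁻¹
      · simp only [g, indicator_of_mem (show ‖z‖ ∈ Iio r⁻¹ from hz)]
        rw [← mul_assoc]
        refine mul_le_mul_of_nonneg_right ?_ hν.le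
        have hz1 : |z ⟨0, hd⟩| ≤ ‖z‖ := by
          simpa using PiLp.norm_apply_le z ⟨0, hd⟩
        have hπ : |r * z ⟨0, hd⟩| ≤ Real.pi := by
          rw [abs_mul, abs_of_pos hr]
          have : r * |z ⟨0, hd⟩| ≤ r * r⁻¹ := by
            gcongr
            exact hz1.trans hz.le
          rw [mul_inv_cancel₀ hr.ne'] at this
          linarith [Real.pi_gt_three]
        have h := Real.cos_le_one_sub_mul_cos_sq hπ
        rw [mul_pow, ← mul_assoc] at h
        linarith
      · simp only [g, indicator_of_notMem (show ‖z‖ ∉ Iio r⁻¹ from hz), mul_zero]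
        exact mul_nonneg (sub_nonneg.2 (Real.cos_le_one _)) hν.le
  refine le_trans ?_ hlow
  rw [integral_const_mul]
  have hφ := H.phiHat_inv_le hd hr'
  have hS := sphereArea_pos hd
  have hI : ∫ z : EuclideanSpace ℝ (Fin d), z ⟨0, hd⟩ ^ 2 * g ‖z‖
      = sphereArea d / d * truncMoment d ν r⁻¹ := by
    rw [div_mul_eq_mul_div, eq_div_iff hd'.ne', ← hmoment, ← hcoord, mul_comm]
  rw [hI]
  calc 2 / Real.pi ^ 2 * (sphereArea d / d) * (phiHat d ν r⁻¹)⁻¹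
      ≤ 2 / Real.pi ^ 2 * (sphereArea d / d) * (truncMoment d ν r⁻¹ / r⁻¹ ^ 2) := by gcongr
    _ = _ := by
      rw [inv_pow, div_inv_eq_mul]
      ring

end NuAssumptions

/-- Two one-sided bounds with different constants combine into a single comparability constant. -/
lemma inv_max_mul_le_and_le_max_mul {m M x y : ℝ} (hm : 0 < m) (hx : 0 < x)
    (hlow : m * x ≤ y) (hup : y ≤ M * x) :
    (max m⁻¹ M)⁻¹ * x ≤ y ∧ y ≤ max m⁻¹ M * x := by
  refine ⟨le_trans ?_ hlow, hup.trans ?_⟩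
  · gcongr
    exact inv_le_of_inv_le₀ hm (le_max_left _ _)
  · gcongr
    exact le_max_right _ _

/-- Ψ is comparable to φ̂(1/r)⁻¹, and the Pruitt function is
comparable to φ̂(r)⁻¹. -/
theorem Psi_comparable_phiHat (d : ℕ) (hd : 0 < d) (ν : ℝ → ℝ) (a b β ℓ a₃ α₃ : ℝ)
    (H : NuAssumptions d ν a b β ℓ a₃ α₃) :
    (∃ c : ℝ, 0 < c ∧ ∀ r : ℝ, 0 < r →
      c⁻¹ * (phiHat d ν r⁻¹)⁻¹ ≤ Psi d hd ν r ∧ Psi d hd ν r ≤ c * (phiHat d ν r⁻¹)⁻¹)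
    ∧ (∃ c' : ℝ, 0 < c' ∧ ∀ r : ℝ, 0 < r →
      c'⁻¹ * (phiHat d ν r)⁻¹
        ≤ (∫ z : EuclideanSpace ℝ (Fin d), min 1 (‖z‖ ^ 2 / r ^ 2) * ν ‖z‖)
      ∧ (∫ z : EuclideanSpace ℝ (Fin d), min 1 (‖z‖ ^ 2 / r ^ 2) * ν ‖z‖)
        ≤ c' * (phiHat d ν r)⁻¹) := by
  have hS := sphereArea_pos hd
  have hd' : (0 : ℝ) < d := by exact_mod_cast hd
  obtain ⟨C, hup⟩ := H.exists_pruitt_le hd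
  constructor
  · have hm : 0 < 2 / Real.pi ^ 2 * (sphereArea d / d) := by positivity
    refine ⟨_, lt_max_of_lt_left (c := 2 * C) (inv_pos.2 hm), fun r hr => ?_⟩
    have hbound : ∀ y ∈ psi d hd ν '' Ioc 0 r, y ≤ 2 * C * (phiHat d ν r⁻¹)⁻¹ := by
      rintro _ ⟨s, hs, rfl⟩
      have h1 := H.psi_le hd hs.1 hs.2
      have h2 := hup r⁻¹ (inv_pos.2 hr)
      linarith
    have hmem : psi d hd ν r ∈ psi d hd ν '' Ioc 0 r := mem_image_of_mem _ ⟨hr, le_rfl⟩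
    exact inv_max_mul_le_and_le_max_mul hm
      (inv_pos.2 (H.phiHat_pos hd (inv_pos.2 hr)))
      ((H.le_psi hd hr).trans (le_csSup ⟨_, hbound⟩ hmem)) (csSup_le ⟨_, hmem⟩ hbound)
  · exact ⟨_, lt_max_of_lt_left (c := C) (inv_pos.2 hS), fun r hr =>
      inv_max_mul_le_and_le_max_mul hS (inv_pos.2 (H.phiHat_pos hd hr))
        (H.phiHat_inv_le_pruitt hd hr) (hup r hr)⟩
end
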